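/- arXiv:1802.05724 — 2 statements merged into one kernel-verified Lean document; each statement's English description precedes it below -/
import Mathlib

section
/- (Bellman function majorizes the r-average; A_p case.) Let p > 1, p1 = -1/(p-1), r ∈ ℝ, and Q₁ > Q > 1. Let Ω_{Q₁} := {(x₁,x₂) ∈ ℝ² : x₁,x₂ > 0, 1 ≤ x₁ · x₂^{p-1} ≤ Q₁}, and let B : Ω_{Q₁} → [0,∞) be continuous and concave along every line segment contained in Ω_{Q₁}, with B(x₁, x₁^{p1}) ≥ x₁^r for all x₁ > 0. Then for every n ≥ 1, every Radon measure μ on ℝⁿ with μ(H) = 0 for every hyperplane H orthogonal to a coordinate axis, every weight w with [w]_p ≤ Q such that w^r is locally μ-integrable, and every axis-parallel rectangular box R with 0 < μ(R) < ∞, one has ⟨w^r⟩_R ≤ B(⟨w⟩_R, ⟨w^{p1}⟩_R). -/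
open MeasureTheory Set Filter

noncomputable section

/-- An axis-parallel open rectangular box in `ℝⁿ` (modelled as `Fin n → ℝ`). -/
def IsBox {n : ℕ} (R : Set (Fin n → ℝ)) : Prop :=
  ∃ a b : Fin n → ℝ, (∀ i, a i < b i) ∧ R = univ.pi fun i => Ioo (a i) (b i)

/-- The average `⟨f⟩_R = (1/μ(R)) ∫_R f dμ`. -/
def boxAvg {n : ℕ} (μ : Measure (Fin n → ℝ)) (R : Set (Fin n → ℝ))
    (f : (Fin n → ℝ) → ℝ) : ℝ :=
  ⨍ x in R, f x ∂μ

/-- Every hyperplane orthogonal to one of the coordinate axes is `μ`-null. -/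
def NullHyperplanes {n : ℕ} (μ : Measure (Fin n → ℝ)) : Prop :=
  ∀ (i : Fin n) (c : ℝ), μ {x | x i = c} = 0

/-- `[w]_p ≤ Q`: the strong Muckenhoupt characteristic of `w` w.r.t. `μ` is at most `Q`;
this includes the requisite integrability of `w` and `w^{-1/(p-1)}` on every box. -/
def ApBound {n : ℕ} (μ : Measure (Fin n → ℝ)) (w : (Fin n → ℝ) → ℝ) (p Q : ℝ) : Prop :=
  ∀ R : Set (Fin n → ℝ), IsBox R → 0 < μ R → μ R < ⊤ →
    IntegrableOn w R μ ∧ IntegrableOn (fun x => w x ^ (-1 / (p - 1))) R μ ∧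
    boxAvg μ R w * (boxAvg μ R fun x => w x ^ (-1 / (p - 1))) ^ (p - 1) ≤ Q

/-- `[w]_{RH_p} ≤ Q`: the strong Reverse Hölder characteristic of `w` w.r.t. `μ` is
at most `Q`, i.e. `⟨w^p⟩_R^{1/p} ≤ Q⟨w⟩_R` on every box. -/
def RHBound {n : ℕ} (μ : Measure (Fin n → ℝ)) (w : (Fin n → ℝ) → ℝ) (p Q : ℝ) : Prop :=
  ∀ R : Set (Fin n → ℝ), IsBox R → 0 < μ R → μ R < ⊤ →
    IntegrableOn w R μ ∧ IntegrableOn (fun x => w x ^ p) R μ ∧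
    (boxAvg μ R fun x => w x ^ p) ^ (1 / p) ≤ Q * boxAvg μ R w

/-- The superlevel sets of `x₁ x₂^q` in the open quadrant are given by the concave function
`log x₁ + q log x₂`. -/
lemma concaveOn_log_add_mul_log {q : ℝ} (hq : 0 ≤ q) :
    ConcaveOn ℝ {x : ℝ × ℝ | 0 < x.1 ∧ 0 < x.2} fun x => Real.log x.1 + q * Real.log x.2 := by
  have hlog := strictConcaveOn_log_Ioi.concaveOn
  have hconv : Convex ℝ {x : ℝ × ℝ | 0 < x.1 ∧ 0 < x.2} := (convex_Ioi (0 : ℝ)).prod (convex_Ioi 0)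
  have h1 := (hlog.comp_linearMap (LinearMap.fst ℝ ℝ ℝ)).subset (fun x hx => hx.1) hconv
  have h2 := (hlog.comp_linearMap (LinearMap.snd ℝ ℝ ℝ)).subset (fun x hx => hx.2) hconv
  exact h1.add (h2.smul hq)

lemma log_mul_rpow {q : ℝ} {x : ℝ × ℝ} (h1 : 0 < x.1) (h2 : 0 < x.2) :
    Real.log (x.1 * x.2 ^ q) = Real.log x.1 + q * Real.log x.2 := by
  rw [Real.log_mul h1.ne' (by positivity), Real.log_rpow h2]

lemma convex_le_mul_rpow {q c : ℝ} (hq : 0 ≤ q) (hc : 0 < c) :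
    Convex ℝ {x : ℝ × ℝ | 0 < x.1 ∧ 0 < x.2 ∧ c ≤ x.1 * x.2 ^ q} := by
  convert (concaveOn_log_add_mul_log hq).convex_ge (Real.log c) using 1
  ext x
  simp only [mem_ofPred_eq, and_assoc]
  refine and_congr_right fun h1 => and_congr_right fun h2 => ?_
  rw [← log_mul_rpow h1 h2, Real.log_le_log_iff hc (by positivity)]

lemma convex_lt_mul_rpow {q c : ℝ} (hq : 0 ≤ q) (hc : 0 < c) :
    Convex ℝ {x : ℝ × ℝ | 0 < x.1 ∧ 0 < x.2 ∧ c < x.1 * x.2 ^ q} := by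
  have heq : {x : ℝ × ℝ | 0 < x.1 ∧ 0 < x.2 ∧ c < x.1 * x.2 ^ q} =
      {x | x ∈ {x : ℝ × ℝ | 0 < x.1 ∧ 0 < x.2} ∧
        Real.log c < Real.log x.1 + q * Real.log x.2} := by
    ext x
    simp only [mem_ofPred_eq, and_assoc]
    refine and_congr_right fun h1 => and_congr_right fun h2 => ?_
    rw [← log_mul_rpow h1 h2, Real.log_lt_log_iff hc (by positivity)]
  rw [heq]
  exact (concaveOn_log_add_mul_log hq).convex_gt (Real.log c)

lemma isClosed_le_mul_rpow {q c : ℝ} (hq : 0 < q) (hc : 0 < c) :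
    IsClosed {x : ℝ × ℝ | 0 < x.1 ∧ 0 < x.2 ∧ c ≤ x.1 * x.2 ^ q} := by
  have : {x : ℝ × ℝ | 0 < x.1 ∧ 0 < x.2 ∧ c ≤ x.1 * x.2 ^ q}
      = {x : ℝ × ℝ | 0 ≤ x.1} ∩ {x | 0 ≤ x.2} ∩ {x | c ≤ x.1 * x.2 ^ q} := by
    ext x
    simp only [mem_ofPred_eq, mem_inter_iff]
    constructor
    · rintro ⟨h1, h2, h3⟩
      exact ⟨⟨h1.le, h2.le⟩, h3⟩
    · rintro ⟨⟨h1, h2⟩, h3⟩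
      refine ⟨h1.lt_of_ne ?_, h2.lt_of_ne ?_, h3⟩ <;> intro h <;> rw [← h] at h3
      · simp at h3; linarith
      · rw [Real.zero_rpow hq.ne', mul_zero] at h3; linarith
  rw [this]
  refine (IsClosed.inter ?_ ?_).inter ?_
  · exact isClosed_le continuous_const continuous_fst
  · exact isClosed_le continuous_const continuous_snd
  · exact isClosed_le continuous_const
      (continuous_fst.mul (continuous_snd.rpow_const fun _ => Or.inr hq.le))

/-- The domain `{x₁, x₂ > 0, 1 ≤ x₁ x₂^q ≤ Q}` of the Bellman function, with `q = p - 1`. -/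
def bellmanDomain (q Q : ℝ) : Set (ℝ × ℝ) :=
  {x | 0 < x.1 ∧ 0 < x.2 ∧ 1 ≤ x.1 * x.2 ^ q ∧ x.1 * x.2 ^ q ≤ Q}

lemma wbtw_or_wbtw_of_wbtw {x y z u : ℝ × ℝ} (hx : Wbtw ℝ y x z) (hu : Wbtw ℝ y u z) :
    Wbtw ℝ y u x ∨ Wbtw ℝ x u z := by
  obtain ⟨s, ⟨hs0, hs1⟩, rfl⟩ := hx
  obtain ⟨t, ⟨ht0, ht1⟩, rfl⟩ := hu
  rcases le_total t s with h | h
  · left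
    have h' : Wbtw ℝ (0 : ℝ) t s := by
      rw [← mem_segment_iff_wbtw, segment_eq_Icc hs0]
      exact ⟨ht0, h⟩
    simpa using h'.map (AffineMap.lineMap y z)
  · right
    have h' : Wbtw ℝ s t (1 : ℝ) := by
      rw [← mem_segment_iff_wbtw, segment_eq_Icc hs1]
      exact ⟨h, ht1⟩
    simpa using h'.map (AffineMap.lineMap y z)

/-- If `x` lies in the domain of level `Q` between `y` and `z`, then the segment from `y` to `z`
can leave the domain of level `Q₁ ≥ Q` only on one side of `x`. -/
lemma segment_le_or_segment_le {q Q Q₁ : ℝ} (hq : 0 ≤ q) (hQ₁ : 0 < Q₁) (hQ : Q ≤ Q₁)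
    {x y z : ℝ × ℝ} (hx : x.1 * x.2 ^ q ≤ Q) (hy : 0 < y.1 ∧ 0 < y.2) (hz : 0 < z.1 ∧ 0 < z.2)
    (h : Wbtw ℝ y x z) :
    (∀ u ∈ segment ℝ y x, u.1 * u.2 ^ q ≤ Q₁) ∨ ∀ u ∈ segment ℝ x z, u.1 * u.2 ^ q ≤ Q₁ := by
  by_contra! hcon
  obtain ⟨⟨u, hu, hu'⟩, v, hv, hv'⟩ := hcon
  have hconv : Convex ℝ {x : ℝ × ℝ | 0 < x.1 ∧ 0 < x.2} := (convex_Ioi (0 : ℝ)).prod (convex_Ioi 0)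
  have hx0 : x ∈ {x : ℝ × ℝ | 0 < x.1 ∧ 0 < x.2} :=
    hconv.segment_subset hy hz (mem_segment_iff_wbtw.2 h)
  have hu0 := hconv.segment_subset hy hx0 hu
  have hv0 := hconv.segment_subset hx0 hz hv
  rw [mem_segment_iff_wbtw] at hu hv
  have hxuv : x ∈ segment ℝ u v :=
    mem_segment_iff_wbtw.2 ((h.trans_left_right hu).trans_right_left hv)
  have := (convex_lt_mul_rpow hq hQ₁).segment_subset ⟨hu0.1, hu0.2, hu'⟩ ⟨hv0.1, hv0.2, hv'⟩ hxuv
  exact absurd this.2.2 (not_lt.2 (hx.trans hQ))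

/-- If `(1 - δ) z ≤ x` coordinatewise, then the segment from `x` to `z` stays below level `Q₁`. -/
lemma segment_le_of_smul_le {q Q Q₁ δ : ℝ} (hq : 0 ≤ q) (hδ0 : 0 < δ) (hδ1 : δ < 1)
    (hδ : Q * ((1 - δ)⁻¹ * (1 - δ)⁻¹ ^ q) ≤ Q₁) {x z : ℝ × ℝ}
    (hx : x.1 * x.2 ^ q ≤ Q) (hx0 : 0 < x.1 ∧ 0 < x.2) (hz : 0 < z.1 ∧ 0 < z.2)
    (h : (1 - δ) • z ≤ x) : ∀ u ∈ segment ℝ x z, u.1 * u.2 ^ q ≤ Q₁ := by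
  intro u hu
  have hδ' : 0 < 1 - δ := by linarith
  have hc : 1 ≤ (1 - δ)⁻¹ := (one_le_inv₀ hδ').2 (by linarith)
  have hconv : Convex ℝ {x : ℝ × ℝ | 0 < x.1 ∧ 0 < x.2} := (convex_Ioi (0 : ℝ)).prod (convex_Ioi 0)
  have hu0 := hconv.segment_subset hx0 hz hu
  have hle : u ≤ (1 - δ)⁻¹ • x := by
    refine (convex_Iic ((1 - δ)⁻¹ • x)).segment_subset ?_ ?_ hu
    · exact ⟨le_mul_of_one_le_left hx0.1.le hc, le_mul_of_one_le_left hx0.2.le hc⟩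
    · rw [mem_Iic, le_inv_smul_iff_of_pos hδ']; exact h
  calc u.1 * u.2 ^ q ≤ ((1 - δ)⁻¹ * x.1) * ((1 - δ)⁻¹ * x.2) ^ q :=
        mul_le_mul hle.1 (Real.rpow_le_rpow hu0.2.le hle.2 hq)
          (Real.rpow_nonneg hu0.2.le _) (mul_nonneg (by positivity) hx0.1.le)
    _ = x.1 * x.2 ^ q * ((1 - δ)⁻¹ * (1 - δ)⁻¹ ^ q) := by
        rw [Real.mul_rpow (by positivity) hx0.2.le]; ring
    _ ≤ Q * ((1 - δ)⁻¹ * (1 - δ)⁻¹ ^ q) := mul_le_mul_of_nonneg_right hx (by positivity)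
    _ ≤ Q₁ := hδ

lemma isClosed_segment_le {q c : ℝ} (hq : 0 ≤ q) {T : Set ℝ} (hT : IsClosed T) {y z : ℝ → ℝ × ℝ}
    (hy : ContinuousOn y T) (hz : ContinuousOn z T) :
    IsClosed {t | t ∈ T ∧ ∀ u ∈ segment ℝ (y t) (z t), u.1 * u.2 ^ q ≤ c} := by
  have : {t | t ∈ T ∧ ∀ u ∈ segment ℝ (y t) (z t), u.1 * u.2 ^ q ≤ c}
      = T ∩ ⋂ s ∈ Icc (0 : ℝ) 1, {t | t ∈ T ∧ (AffineMap.lineMap (y t) (z t) s).1 *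
        (AffineMap.lineMap (y t) (z t) s).2 ^ q ≤ c} := by
    ext t
    simp only [mem_ofPred_eq, mem_inter_iff, mem_iInter, segment_eq_image_lineMap, forall_mem_image]
    exact ⟨fun h => ⟨h.1, fun s hs => ⟨h.1, h.2 hs⟩⟩, fun h => ⟨h.1, fun s hs => (h.2 s hs).2⟩⟩
  rw [this]
  refine hT.inter (isClosed_biInter fun (s : ℝ) _ => ?_)
  have hcont : ContinuousOn (fun t => AffineMap.lineMap (k := ℝ) (y t) (z t) s) T := by
    simp only [AffineMap.lineMap_apply_module]
    fun_prop
  have h2 : ContinuousOn (fun t => (AffineMap.lineMap (y t) (z t) s).1 *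
        (AffineMap.lineMap (y t) (z t) s).2 ^ q) T :=
    hcont.fst.mul (hcont.snd.rpow_const fun _ _ => Or.inr hq)
  exact h2.preimage_isClosed_of_isClosed hT isClosed_Iic

/-- Along a path of splittings `x ∈ [y t, z t]` whose right endpoint starts close to `x` and whose
left endpoint ends close to `x`, some segment lies in the larger domain. -/
lemma exists_segment_subset_bellmanDomain {q Q Q₁ δ : ℝ} (hq : 0 ≤ q) (hQ₁ : 0 < Q₁) (hQ : Q ≤ Q₁)
    (hδ0 : 0 < δ) (hδ1 : δ < 1) (hδ : Q * ((1 - δ)⁻¹ * (1 - δ)⁻¹ ^ q) ≤ Q₁)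
    {x : ℝ × ℝ} (hx : x ∈ bellmanDomain q Q) {α β : ℝ} (hαβ : α ≤ β) {y z : ℝ → ℝ × ℝ}
    (hy : ContinuousOn y (Icc α β)) (hz : ContinuousOn z (Icc α β))
    (hymem : ∀ t ∈ Icc α β, y t ∈ bellmanDomain q Q)
    (hzmem : ∀ t ∈ Icc α β, z t ∈ bellmanDomain q Q)
    (hbtw : ∀ t ∈ Icc α β, x ∈ segment ℝ (y t) (z t))
    (hα : (1 - δ) • z α ≤ x) (hβ : (1 - δ) • y β ≤ x) :
    ∃ t ∈ Icc α β, segment ℝ (y t) (z t) ⊆ bellmanDomain q Q₁ := by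
  obtain ⟨hx1, hx2, -, hxQ⟩ := hx
  have hpos : ∀ {u}, u ∈ bellmanDomain q Q → 0 < u.1 ∧ 0 < u.2 := fun h => ⟨h.1, h.2.1⟩
  have hαm : α ∈ Icc α β := left_mem_Icc.2 hαβ
  have hβm : β ∈ Icc α β := right_mem_Icc.2 hαβ
  obtain ⟨t, ht, ⟨-, ht1⟩, -, ht2⟩ := isPreconnected_closed_iff.1 isPreconnected_Icc _ _
    (isClosed_segment_le (c := Q₁) hq isClosed_Icc continuousOn_const hz)
    (isClosed_segment_le (c := Q₁) hq isClosed_Icc hy continuousOn_const)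
    (fun t ht => (segment_le_or_segment_le hq hQ₁ hQ hxQ (hpos (hymem t ht)) (hpos (hzmem t ht))
      (mem_segment_iff_wbtw.1 (hbtw t ht))).symm.imp (fun h => ⟨ht, h⟩) fun h => ⟨ht, h⟩)
    ⟨α, hαm, hαm,
      segment_le_of_smul_le hq hδ0 hδ1 hδ hxQ ⟨hx1, hx2⟩ (hpos (hzmem α hαm)) hα⟩
    ⟨β, hβm, hβm, by
      rw [segment_symm]
      exact segment_le_of_smul_le hq hδ0 hδ1 hδ hxQ ⟨hx1, hx2⟩ (hpos (hymem β hβm)) hβ⟩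
  refine ⟨t, ht, fun u hu => ?_⟩
  obtain ⟨hy1, hy2, hy3, -⟩ := hymem t ht
  obtain ⟨hz1, hz2, hz3, -⟩ := hzmem t ht
  have hlow := (convex_le_mul_rpow hq one_pos).segment_subset ⟨hy1, hy2, hy3⟩ ⟨hz1, hz2, hz3⟩ hu
  refine ⟨hlow.1, hlow.2.1, hlow.2.2, ?_⟩
  rcases wbtw_or_wbtw_of_wbtw (mem_segment_iff_wbtw.1 (hbtw t ht)) (mem_segment_iff_wbtw.1 hu)
    with h | h
  · exact ht2 u (mem_segment_iff_wbtw.2 h)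
  · exact ht1 u (mem_segment_iff_wbtw.2 h)

lemma exists_splitting_ratio {q Q Q₁ : ℝ} (hQ : Q < Q₁) :
    ∃ δ : ℝ, 0 < δ ∧ δ < 1 / 2 ∧ Q * ((1 - δ)⁻¹ * (1 - δ)⁻¹ ^ q) ≤ Q₁ := by
  have hcont : ContinuousAt (fun δ : ℝ => Q * ((1 - δ)⁻¹ * (1 - δ)⁻¹ ^ q)) 0 := by
    have h : ContinuousAt (fun δ : ℝ => (1 - δ)⁻¹) 0 :=
      (continuousAt_const.sub continuousAt_id).inv₀ (by simp)
    exact continuousAt_const.mul (h.mul (h.rpow_const (Or.inl (by simp))))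
  have h1 : ∀ᶠ δ in nhds (0 : ℝ), Q * ((1 - δ)⁻¹ * (1 - δ)⁻¹ ^ q) < Q₁ :=
    hcont.eventually (gt_mem_nhds (by simpa using hQ))
  have h2 : ∀ᶠ δ in nhds (0 : ℝ), δ < 1 / 2 := gt_mem_nhds (by norm_num)
  obtain ⟨δ, ⟨hδ1, hδ2⟩, hδ0⟩ :=
    (((h1.and h2).filter_mono nhdsWithin_le_nhds).and
      (self_mem_nhdsWithin : Ioi (0 : ℝ) ∈ nhdsWithin 0 (Ioi 0))).exists
  exact ⟨δ, hδ0, hδ2, hδ1.le⟩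

/-- The half-open box `∏ (aᵢ, bᵢ]`; half-open boxes can be split exactly into two. -/
def halfOpenBox {n : ℕ} (a b : Fin n → ℝ) : Set (Fin n → ℝ) :=
  univ.pi fun i => Ioc (a i) (b i)

lemma mem_halfOpenBox {n : ℕ} {a b x : Fin n → ℝ} :
    x ∈ halfOpenBox a b ↔ ∀ i, a i < x i ∧ x i ≤ b i := by
  simp [halfOpenBox]

lemma measurableSet_halfOpenBox {n : ℕ} (a b : Fin n → ℝ) : MeasurableSet (halfOpenBox a b) :=
  MeasurableSet.univ_pi fun _ => measurableSet_Ioc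

lemma halfOpenBox_update_right {n : ℕ} {a b : Fin n → ℝ} {i : Fin n} {t : ℝ} (ht : t ≤ b i) :
    halfOpenBox a (Function.update b i t) = halfOpenBox a b ∩ {x | x i ≤ t} := by
  ext x
  simp only [mem_inter_iff, mem_halfOpenBox, mem_ofPred_eq]
  constructor
  · intro h
    have hi : x i ≤ t := by simpa using (h i).2
    refine ⟨fun j => ⟨(h j).1, ?_⟩, hi⟩
    rcases eq_or_ne j i with rfl | hj
    · exact hi.trans ht
    · simpa [hj] using (h j).2
  · rintro ⟨h, hi⟩ j
    refine ⟨(h j).1, ?_⟩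
    rcases eq_or_ne j i with rfl | hj
    · simpa using hi
    · simpa [hj] using (h j).2

lemma halfOpenBox_update_left {n : ℕ} {a b : Fin n → ℝ} {i : Fin n} {t : ℝ} (ht : a i ≤ t) :
    halfOpenBox (Function.update a i t) b = halfOpenBox a b ∩ {x | t < x i} := by
  ext x
  simp only [mem_inter_iff, mem_halfOpenBox, mem_ofPred_eq]
  constructor
  · intro h
    have hi : t < x i := by simpa using (h i).1
    refine ⟨fun j => ⟨?_, (h j).2⟩, hi⟩
    rcases eq_or_ne j i with rfl | hj
    · exact ht.trans_lt hi
    · simpa [hj] using (h j).1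
  · rintro ⟨h, hi⟩ j
    refine ⟨?_, (h j).2⟩
    rcases eq_or_ne j i with rfl | hj
    · simpa using hi
    · simpa [hj] using (h j).1

lemma disjoint_halfOpenBox_update {n : ℕ} {a b : Fin n → ℝ} {i : Fin n} {t : ℝ} :
    Disjoint (halfOpenBox a (Function.update b i t)) (halfOpenBox (Function.update a i t) b) := by
  refine Set.disjoint_left.2 fun x hx hx' => ?_
  have h1 := (mem_halfOpenBox.1 hx i).2
  have h2 := (mem_halfOpenBox.1 hx' i).1
  simp only [Function.update_self] at h1 h2
  linarith

lemma halfOpenBox_update_union {n : ℕ} {a b : Fin n → ℝ} {i : Fin n} {t : ℝ}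
    (ht : t ∈ Icc (a i) (b i)) :
    halfOpenBox a (Function.update b i t) ∪ halfOpenBox (Function.update a i t) b =
      halfOpenBox a b := by
  rw [halfOpenBox_update_right ht.2, halfOpenBox_update_left ht.1, ← inter_union_distrib_left]
  refine inter_eq_left.2 fun x _ => ?_
  exact le_or_gt (x i) t

lemma measure_halfOpenBox_ne_top {n : ℕ} {μ : Measure (Fin n → ℝ)} [IsLocallyFiniteMeasure μ]
    (a b : Fin n → ℝ) : μ (halfOpenBox a b) ≠ ⊤ := by
  refine ((measure_mono ?_).trans_lt (isCompact_Icc (a := a) (b := b)).measure_lt_top).ne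
  intro x hx
  rw [mem_halfOpenBox] at hx
  exact ⟨fun i => (hx i).1.le, fun i => (hx i).2⟩

lemma halfOpenBox_ae_eq {n : ℕ} {μ : Measure (Fin n → ℝ)} (hnull : NullHyperplanes μ)
    (a b : Fin n → ℝ) : (univ.pi fun i => Ioo (a i) (b i)) =ᵐ[μ] halfOpenBox a b := by
  have h : ∀ᵐ x ∂μ, ∀ i, x i ≠ b i := ae_all_iff.2 fun i => by
    simpa [ae_iff] using hnull i (b i)
  filter_upwards [h] with x hx
  apply propext
  change x ∈ (univ.pi fun i => Ioo (a i) (b i)) ↔ x ∈ halfOpenBox a b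
  simp only [mem_halfOpenBox, Set.mem_pi, mem_univ, true_implies, mem_Ioo]
  exact forall_congr' fun i => and_congr_right fun _ =>
    ⟨le_of_lt, fun h' => lt_of_le_of_ne h' (hx i)⟩

lemma continuous_setIntegral_inter_le {n : ℕ} {E : Type*} [NormedAddCommGroup E]
    [NormedSpace ℝ E] {μ : Measure (Fin n → ℝ)} (hnull : NullHyperplanes μ)
    {S : Set (Fin n → ℝ)} {f : (Fin n → ℝ) → E} (hf : IntegrableOn f S μ) (i : Fin n) :
    Continuous fun t : ℝ => ∫ x in S ∩ {x | x i ≤ t}, f x ∂μ := by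
  have hmeas : ∀ t : ℝ, MeasurableSet {x : Fin n → ℝ | x i ≤ t} := fun t =>
    measurableSet_le (measurable_pi_apply i) measurable_const
  have heq : ∀ t : ℝ, ∫ x in S ∩ {x | x i ≤ t}, f x ∂μ =
      ∫ x in S, {x | x i ≤ t}.indicator f x ∂μ := fun t => by
    rw [integral_indicator (hmeas t), Measure.restrict_restrict (hmeas t), inter_comm]
  simp_rw [heq]
  refine continuous_iff_continuousAt.2 fun t => ?_
  refine continuousAt_of_dominated (bound := fun x => ‖f x‖) ?_ ?_ hf.norm ?_
  · exact Eventually.of_forall fun s => hf.aestronglyMeasurable.indicator (hmeas s)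
  · exact Eventually.of_forall fun s => Eventually.of_forall fun x => norm_indicator_le_norm_self _ _
  · have h : ∀ᵐ x ∂μ.restrict S, x i ≠ t := by
      refine ae_restrict_of_ae ?_
      simpa [ae_iff] using hnull i t
    filter_upwards [h] with x hx
    rcases lt_or_gt_of_ne hx with h' | h'
    · refine (continuousAt_const (y := f x)).congr ?_
      filter_upwards [lt_mem_nhds h'] with s hs
      rw [indicator_of_mem]
      exact hs.le
    · refine (continuousAt_const (y := (0 : E))).congr ?_
      filter_upwards [gt_mem_nhds h'] with s hs
      rw [indicator_of_notMem]
      exact not_le.2 hs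

lemma measureReal_smul_setAverage_union {α E : Type*} [MeasurableSpace α] [NormedAddCommGroup E]
    [NormedSpace ℝ E] [CompleteSpace E] {μ : Measure α} {f : α → E} {S L R : Set α}
    (hS : L ∪ R = S) (hLR : Disjoint L R) (hR : MeasurableSet R) (hfin : μ S ≠ ⊤)
    (hf : IntegrableOn f S μ) :
    μ.real L • (⨍ x in L, f x ∂μ) + μ.real R • (⨍ x in R, f x ∂μ) =
      μ.real S • ⨍ x in S, f x ∂μ := by
  have hL : μ L ≠ ⊤ := measure_ne_top_of_subset (hS ▸ subset_union_left) hfin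
  have hR' : μ R ≠ ⊤ := measure_ne_top_of_subset (hS ▸ subset_union_right) hfin
  rw [measure_smul_setAverage _ hL, measure_smul_setAverage _ hR', measure_smul_setAverage _ hfin,
    ← hS, setIntegral_union hLR hR (hf.mono_set (hS ▸ subset_union_left))
      (hf.mono_set (hS ▸ subset_union_right))]

/-- Every box can be split orthogonally to a given axis, with a lower bound on the proportions,
so that the segment between the averages over the two halves lies in the larger domain. -/
lemma exists_split {n : ℕ} {μ : Measure (Fin n → ℝ)} [IsLocallyFiniteMeasure μ]
    (hnull : NullHyperplanes μ) {f : (Fin n → ℝ) → ℝ × ℝ} {q Q Q₁ δ : ℝ} (hq : 0 ≤ q)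
    (hQ₁ : 0 < Q₁) (hQ : Q ≤ Q₁) (hδ0 : 0 < δ) (hδ1 : δ < 1 / 2)
    (hδ : Q * ((1 - δ)⁻¹ * (1 - δ)⁻¹ ^ q) ≤ Q₁)
    (hf : ∀ a b : Fin n → ℝ, (∀ i, a i < b i) → μ (halfOpenBox a b) ≠ 0 →
      IntegrableOn f (halfOpenBox a b) μ ∧
        ⨍ x in halfOpenBox a b, f x ∂μ ∈ bellmanDomain q Q)
    {a b : Fin n → ℝ} (hab : ∀ i, a i < b i) (hμ : μ (halfOpenBox a b) ≠ 0) (i : Fin n) :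
    ∃ t ∈ Ioo (a i) (b i),
      μ.real (halfOpenBox a (Function.update b i t)) ∈
        Icc (δ * μ.real (halfOpenBox a b)) ((1 - δ) * μ.real (halfOpenBox a b)) ∧
      segment ℝ (⨍ x in halfOpenBox a (Function.update b i t), f x ∂μ)
        (⨍ x in halfOpenBox (Function.update a i t) b, f x ∂μ) ⊆ bellmanDomain q Q₁ := by
  set S := halfOpenBox a b with hS
  obtain ⟨hfS, hX⟩ := hf a b hab hμ
  have hSfin : μ S ≠ ⊤ := measure_halfOpenBox_ne_top a b
  have hm0 : 0 < μ.real S := ENNReal.toReal_pos hμ hSfin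
  set M : ℝ → ℝ := fun t => μ.real (S ∩ {x | x i ≤ t}) with hM
  have hMcont : Continuous M := by
    have := continuous_setIntegral_inter_le hnull (f := fun _ => (1 : ℝ))
      (integrableOn_const hSfin : IntegrableOn (fun _ => (1 : ℝ)) S μ) i
    simpa [hM] using this
  have hMmono : Monotone M := fun s t hst =>
    measureReal_mono (inter_subset_inter_right _ fun x (hx : x i ≤ s) => hx.trans hst)
      (measure_ne_top_of_subset inter_subset_left hSfin)
  have hMa : M (a i) = 0 := by
    have : S ∩ {x | x i ≤ a i} = ∅ := by
      ext x
      simp only [hS, mem_inter_iff, mem_halfOpenBox, mem_ofPred_eq, mem_empty_iff_false, iff_false]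
      rintro ⟨h, h'⟩
      exact absurd (h i).1 (not_lt.2 h')
    simp [hM, this]
  have hMb : M (b i) = μ.real S := by
    have : S ∩ {x | x i ≤ b i} = S := inter_eq_left.2 fun x hx => (mem_halfOpenBox.1 hx i).2
    simp [hM, this]
  obtain ⟨α, hαm, hα⟩ : ∃ α ∈ Icc (a i) (b i), M α = δ * μ.real S :=
    intermediate_value_Icc (hab i).le hMcont.continuousOn
      ⟨by rw [hMa]; positivity, by rw [hMb]; nlinarith⟩
  obtain ⟨β, hβm, hβ⟩ : ∃ β ∈ Icc α (b i), M β = (1 - δ) * μ.real S :=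
    intermediate_value_Icc hαm.2 hMcont.continuousOn
      ⟨by rw [hα]; nlinarith, by rw [hMb]; nlinarith⟩
  have hMmem : ∀ t ∈ Icc α β, M t ∈ Icc (δ * μ.real S) ((1 - δ) * μ.real S) := fun t ht =>
    ⟨hα ▸ hMmono ht.1, hβ ▸ hMmono ht.2⟩
  have htmem : ∀ t ∈ Icc α β, t ∈ Ioo (a i) (b i) := fun t ht => by
    obtain ⟨h1, h2⟩ := hMmem t ht
    refine ⟨lt_of_le_of_ne (hαm.1.trans ht.1) ?_, lt_of_le_of_ne (ht.2.trans hβm.2) ?_⟩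
    · rintro rfl
      rw [hMa] at h1
      nlinarith
    · rintro rfl
      rw [hMb] at h2
      nlinarith
  set L : ℝ → Set (Fin n → ℝ) := fun t => halfOpenBox a (Function.update b i t) with hL
  set R : ℝ → Set (Fin n → ℝ) := fun t => halfOpenBox (Function.update a i t) b with hR
  have hLM : ∀ t ∈ Icc α β, μ.real (L t) = M t := fun t ht => by
    simp only [hL, hM]
    rw [halfOpenBox_update_right (htmem t ht).2.le]
  have hunion : ∀ t ∈ Icc α β, L t ∪ R t = S := fun t ht =>
    halfOpenBox_update_union (Ioo_subset_Icc_self (htmem t ht))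
  have hRM : ∀ t ∈ Icc α β, μ.real (R t) = μ.real S - M t := fun t ht => by
    rw [← hLM t ht, ← hunion t ht, measureReal_union disjoint_halfOpenBox_update
      (measurableSet_halfOpenBox _ _) (measure_halfOpenBox_ne_top _ _)
      (measure_halfOpenBox_ne_top _ _)]
    ring
  have hLpos : ∀ t ∈ Icc α β, 0 < μ.real (L t) := fun t ht => by
    rw [hLM t ht]
    exact (by positivity : 0 < δ * μ.real S).trans_le (hMmem t ht).1
  have hRpos : ∀ t ∈ Icc α β, 0 < μ.real (R t) := fun t ht => by
    rw [hRM t ht]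
    have := (hMmem t ht).2
    nlinarith
  have hadd : ∀ t ∈ Icc α β, μ.real (L t) • (⨍ x in L t, f x ∂μ) +
      μ.real (R t) • (⨍ x in R t, f x ∂μ) = μ.real S • ⨍ x in S, f x ∂μ := fun t ht =>
    measureReal_smul_setAverage_union (hunion t ht) disjoint_halfOpenBox_update
      (measurableSet_halfOpenBox _ _) hSfin hfS
  have hsum : ∀ t ∈ Icc α β, μ.real (L t) + μ.real (R t) = μ.real S := fun t ht => by
    rw [hLM t ht, hRM t ht]; ring
  have hLX : ∀ t ∈ Icc α β, ⨍ x in L t, f x ∂μ ∈ bellmanDomain q Q := fun t ht => by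
    refine (hf _ _ (fun j => ?_) fun h0 => (hLpos t ht).ne' (by simp [hL, measureReal_def, h0])).2
    rcases eq_or_ne j i with rfl | hj
    · simpa using (htmem t ht).1
    · simpa [hj] using hab j
  have hRX : ∀ t ∈ Icc α β, ⨍ x in R t, f x ∂μ ∈ bellmanDomain q Q := fun t ht => by
    refine (hf _ _ (fun j => ?_) fun h0 => (hRpos t ht).ne' (by simp [hR, measureReal_def, h0])).2
    rcases eq_or_ne j i with rfl | hj
    · simpa using (htmem t ht).2
    · simpa [hj] using hab j
  have hFcont := continuous_setIntegral_inter_le hnull hfS i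
  have hLcont : ContinuousOn (fun t => ⨍ x in L t, f x ∂μ) (Icc α β) := by
    have : ContinuousOn (fun t => (M t)⁻¹ • ∫ x in S ∩ {x | x i ≤ t}, f x ∂μ) (Icc α β) := by
      refine ContinuousOn.smul (hMcont.continuousOn.inv₀ fun t ht => ?_) hFcont.continuousOn
      rw [← hLM t ht]
      exact (hLpos t ht).ne'
    refine this.congr fun t ht => ?_
    simp only
    rw [setAverage_eq, hLM t ht, hL]
    simp only
    rw [halfOpenBox_update_right (htmem t ht).2.le]
  have hRcont : ContinuousOn (fun t => ⨍ x in R t, f x ∂μ) (Icc α β) := by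
    have : ContinuousOn (fun t => (μ.real S - M t)⁻¹ •
        ((μ.real S • ⨍ x in S, f x ∂μ) - M t • ⨍ x in L t, f x ∂μ)) (Icc α β) := by
      refine ContinuousOn.smul
        ((continuousOn_const.sub hMcont.continuousOn).inv₀ fun t ht => ?_)
        (continuousOn_const.sub (hMcont.continuousOn.smul hLcont))
      exact (hRM t ht ▸ hRpos t ht).ne'
    refine this.congr fun t ht => ?_
    simp only
    rw [← hRM t ht, ← hLM t ht, eq_inv_smul_iff₀ (hRpos t ht).ne', ← hadd t ht]
    abel
  have hαβ : α ≤ β := hβm.1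
  have hαI : α ∈ Icc α β := left_mem_Icc.2 hαβ
  have hβI : β ∈ Icc α β := right_mem_Icc.2 hαβ
  obtain ⟨t, ht, hseg⟩ := exists_segment_subset_bellmanDomain hq hQ₁ hQ hδ0 (by linarith) hδ hX hαβ
    hLcont hRcont hLX hRX
    (fun t ht => ⟨μ.real (L t) / μ.real S, μ.real (R t) / μ.real S, by positivity, by positivity,
      by rw [← add_div, hsum t ht, div_self hm0.ne'], by
        rw [div_eq_inv_mul, div_eq_inv_mul, mul_smul, mul_smul, ← smul_add, hadd t ht,
          inv_smul_smul₀ hm0.ne']⟩)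
    (by
      have h := hadd α hαI
      rw [hLM α hαI, hRM α hαI, hα] at h
      have hY := hLX α hαI
      rw [← smul_le_smul_iff_of_pos_left hm0, ← h, smul_smul,
        show μ.real S - δ * μ.real S = μ.real S * (1 - δ) by ring]
      exact le_add_of_nonneg_left
        (smul_nonneg (by positivity) (Prod.mk_le_mk.2 ⟨hY.1.le, hY.2.1.le⟩)))
    (by
      have h := hadd β hβI
      rw [hLM β hβI, hRM β hβI, hβ] at h
      have hY := hRX β hβI
      rw [← smul_le_smul_iff_of_pos_left hm0, ← h, smul_smul, mul_comm (μ.real S) (1 - δ)]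
      exact le_add_of_nonneg_right
        (smul_nonneg (by nlinarith) (Prod.mk_le_mk.2 ⟨hY.1.le, hY.2.1.le⟩)))
  exact ⟨t, htmem t ht, (hLM t ht).symm ▸ hMmem t ht, hseg⟩

section Tree

variable {α G : Type*}

open Classical in
/-- The child of the cell `D` (with children `L D` and `R D`) containing the point `x`. -/
def treeStep (S : G → Set α) (L R : G → G) (x : α) (D : G) : G :=
  if x ∈ S (L D) then L D else R D

/-- The descendant of generation `k` of the cell `D` containing the point `x`. -/
def treeCell (S : G → Set α) (L R : G → G) (k : ℕ) (D : G) (x : α) : G :=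
  (treeStep S L R x)^[k] D

/-- `L D` and `R D` split the cell `D` into two disjoint pieces. -/
structure IsSplitting (S : G → Set α) (L R : G → G) : Prop where
  union : ∀ D, S (L D) ∪ S (R D) = S D
  disjoint : ∀ D, Disjoint (S (L D)) (S (R D))

variable {S : G → Set α} {L R : G → G}

lemma treeCell_zero (D : G) (x : α) : treeCell S L R 0 D x = D := rfl

lemma treeCell_succ (k : ℕ) (D : G) (x : α) :
    treeCell S L R (k + 1) D x = treeCell S L R k (treeStep S L R x D) x := rfl

lemma treeCell_succ' (k : ℕ) (D : G) (x : α) :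
    treeCell S L R (k + 1) D x = treeStep S L R x (treeCell S L R k D x) :=
  Function.iterate_succ_apply' _ _ _

lemma treeStep_of_mem_left {D : G} {x : α} (hx : x ∈ S (L D)) : treeStep S L R x D = L D :=
  if_pos hx

namespace IsSplitting

lemma treeStep_of_mem_right (h : IsSplitting S L R) {D : G} {x : α} (hx : x ∈ S (R D)) :
    treeStep S L R x D = R D :=
  if_neg fun hx' => disjoint_left.1 (h.disjoint D) hx' hx

lemma mem_treeStep (h : IsSplitting S L R) {D : G} {x : α} (hx : x ∈ S D) :
    x ∈ S (treeStep S L R x D) := by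
  rw [← h.union D] at hx
  rcases hx with hx | hx
  · rwa [treeStep_of_mem_left hx]
  · rwa [h.treeStep_of_mem_right hx]

lemma treeStep_subset (h : IsSplitting S L R) (D : G) (x : α) :
    S (treeStep S L R x D) ⊆ S D := by
  rw [← h.union D, treeStep]
  split_ifs
  · exact subset_union_left
  · exact subset_union_right

lemma mem_treeCell (h : IsSplitting S L R) {D : G} {x : α} (hx : x ∈ S D) (k : ℕ) :
    x ∈ S (treeCell S L R k D x) := by
  induction k with
  | zero => exact hx
  | succ k ih => rw [treeCell_succ']; exact h.mem_treeStep ih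

lemma treeCell_subset (h : IsSplitting S L R) (D : G) (x : α) (k : ℕ) :
    S (treeCell S L R k D x) ⊆ S D := by
  induction k with
  | zero => exact subset_rfl
  | succ k ih => rw [treeCell_succ']; exact (h.treeStep_subset _ _).trans ih

lemma treeCell_eq_of_mem (h : IsSplitting S L R) {D : G} {x y : α} {k : ℕ}
    (hy : y ∈ S (treeCell S L R k D x)) : treeCell S L R k D y = treeCell S L R k D x := by
  induction k with
  | zero => rfl
  | succ k ih =>
    rw [treeCell_succ'] at hy
    have ih := ih (h.treeStep_subset _ _ hy)
    rw [treeCell_succ', treeCell_succ', ih]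
    by_cases hx : x ∈ S (L (treeCell S L R k D x))
    · rw [treeStep_of_mem_left hx] at hy
      rw [treeStep_of_mem_left hx, treeStep_of_mem_left hy]
    · have hR : treeStep S L R x (treeCell S L R k D x) = R (treeCell S L R k D x) := if_neg hx
      rw [hR] at hy
      rw [hR, h.treeStep_of_mem_right hy]

variable [MeasurableSpace α]

lemma measurable_treeCell {β : Type*} [MeasurableSpace β] (hS : ∀ D, MeasurableSet (S D))
    (F : G → β) (k : ℕ) (D : G) : Measurable fun x => F (treeCell S L R k D x) := by
  classical
  induction k generalizing D with
  | zero => simp only [treeCell_zero, measurable_const]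
  | succ k ih =>
    have : (fun x => F (treeCell S L R (k + 1) D x)) = fun x =>
        if x ∈ S (L D) then F (treeCell S L R k (L D) x) else F (treeCell S L R k (R D) x) := by
      ext x
      rw [treeCell_succ, treeStep]
      split_ifs <;> rfl
    rw [this]
    exact Measurable.ite (hS _) (ih _) (ih _)

lemma lintegral_treeCell_le (h : IsSplitting S L R) (hS : ∀ D, MeasurableSet (S D))
    {μ : Measure α} {ψ : G → ENNReal}
    (hψ : ∀ D, μ (S (L D)) * ψ (L D) + μ (S (R D)) * ψ (R D) ≤ μ (S D) * ψ D) (k : ℕ) (D : G) :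
    ∫⁻ x in S D, ψ (treeCell S L R k D x) ∂μ ≤ μ (S D) * ψ D := by
  induction k generalizing D with
  | zero => simp [treeCell_zero, mul_comm]
  | succ k ih =>
    calc ∫⁻ x in S D, ψ (treeCell S L R (k + 1) D x) ∂μ
        = ∫⁻ x in S (L D), ψ (treeCell S L R (k + 1) D x) ∂μ +
          ∫⁻ x in S (R D), ψ (treeCell S L R (k + 1) D x) ∂μ := by
          rw [← h.union D, lintegral_union (hS _) (h.disjoint D)]
      _ = ∫⁻ x in S (L D), ψ (treeCell S L R k (L D) x) ∂μ +
          ∫⁻ x in S (R D), ψ (treeCell S L R k (R D) x) ∂μ := by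
          congr 1
          · refine setLIntegral_congr_fun (hS _) fun x hx => ?_
            simp only [treeCell_succ, treeStep_of_mem_left hx]
          · refine setLIntegral_congr_fun (hS _) fun x hx => ?_
            simp only [treeCell_succ, h.treeStep_of_mem_right hx]
      _ ≤ _ := (add_le_add (ih _) (ih _)).trans (hψ D)

lemma measure_treeCell_le {μ : Measure α} {c : ENNReal}
    (hL : ∀ D, μ (S (L D)) ≤ c * μ (S D)) (hR : ∀ D, μ (S (R D)) ≤ c * μ (S D)) (D : G) (x : α)
    (k : ℕ) : μ (S (treeCell S L R k D x)) ≤ c ^ k * μ (S D) := by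
  induction k with
  | zero => simp [treeCell_zero]
  | succ k ih =>
    rw [treeCell_succ', pow_succ', mul_assoc]
    refine le_trans ?_ (mul_le_mul_right ih c)
    rw [treeStep]
    split_ifs
    · exact hL _
    · exact hR _

lemma lintegral_enorm_average_treeCell_le {E : Type*} [NormedAddCommGroup E] [NormedSpace ℝ E]
    (h : IsSplitting S L R) (hS : ∀ D, MeasurableSet (S D)) {μ : Measure α}
    (hfin : ∀ D, μ (S D) ≠ ⊤) (f : α → E) (k : ℕ) (D : G) :
    ∫⁻ x in S D, ‖⨍ y in S (treeCell S L R k D x), f y ∂μ‖ₑ ∂μ ≤ ∫⁻ x in S D, ‖f x‖ₑ ∂μ := by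
  calc ∫⁻ x in S D, ‖⨍ y in S (treeCell S L R k D x), f y ∂μ‖ₑ ∂μ
      ≤ ∫⁻ x in S D, (fun C => ⨍⁻ y in S C, ‖f y‖ₑ ∂μ) (treeCell S L R k D x) ∂μ :=
        lintegral_mono fun x => enorm_integral_le_lintegral_enorm _
    _ ≤ μ (S D) * ⨍⁻ y in S D, ‖f y‖ₑ ∂μ := by
        refine h.lintegral_treeCell_le hS (ψ := fun C => ⨍⁻ y in S C, ‖f y‖ₑ ∂μ)
          (fun C => ?_) k D
        simp only [measure_mul_setLAverage _ (hfin _)]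
        rw [← lintegral_union (hS _) (h.disjoint C), h.union C]
    _ = _ := measure_mul_setLAverage _ (hfin _)

end IsSplitting

end Tree

lemma tendsto_setAverage_of_continuous {n : ℕ} {E : Type*} [NormedAddCommGroup E]
    [NormedSpace ℝ E] [CompleteSpace E] {μ : Measure (Fin n → ℝ)} {A : ℕ → Set (Fin n → ℝ)}
    (hA : ∀ k, MeasurableSet (A k)) (hA0 : ∀ k, μ (A k) ≠ 0) (hAtop : ∀ k, μ (A k) ≠ ⊤)
    {x : Fin n → ℝ} (hx : ∀ U ∈ nhds x, ∀ᶠ k in atTop, A k ⊆ U)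
    {g : (Fin n → ℝ) → E} (hg : Continuous g) (hgi : ∀ k, IntegrableOn g (A k) μ) :
    Tendsto (fun k => ⨍ y in A k, g y ∂μ) atTop (nhds (g x)) := by
  rw [Metric.nhds_basis_closedBall.tendsto_right_iff]
  intro ε hε
  filter_upwards [hx _ (hg.continuousAt.preimage_mem_nhds (Metric.closedBall_mem_nhds (g x) hε))]
    with k hk
  exact (convex_closedBall _ _).set_average_mem Metric.isClosed_closedBall (hA0 k) (hAtop k)
    (ae_restrict_of_forall_mem (hA k) fun y hy => hk hy) (hgi k)

namespace IsSplitting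

/-- If almost every point is the limit of the cells containing it, then the averages of an
integrable function over the cells converge to the function in `L¹`. -/
lemma tendsto_lintegral_treeCell {n : ℕ} {G : Type*} {S : G → Set (Fin n → ℝ)} {L R : G → G}
    (h : IsSplitting S L R) (hS : ∀ D, MeasurableSet (S D)) {μ : Measure (Fin n → ℝ)}
    (hμ0 : ∀ D, μ (S D) ≠ 0) (hfin : ∀ D, μ (S D) ≠ ⊤) {D : G}
    (hshrink : ∀ᵐ x ∂μ.restrict (S D), ∀ U ∈ nhds x, ∀ᶠ k in atTop, S (treeCell S L R k D x) ⊆ U)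
    {f : (Fin n → ℝ) → ℝ × ℝ} (hf : IntegrableOn f (S D) μ) :
    Tendsto (fun k => ∫⁻ x in S D, ‖(⨍ y in S (treeCell S L R k D x), f y ∂μ) - f x‖ₑ ∂μ)
      atTop (nhds 0) := by
  rw [ENNReal.tendsto_nhds_zero]
  intro ε hε
  have : IsFiniteMeasure (μ.restrict (S D)) := isFiniteMeasure_restrict.2 (hfin D)
  have hε3 : ε / 3 ≠ 0 := by simp [hε.ne']
  obtain ⟨g, hgc, hfg, hg, hgi⟩ := Integrable.exists_hasCompactSupport_lintegral_sub_le hf hε3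
  obtain ⟨C, hC⟩ := hg.bounded_above_of_compact_support hgc
  have hsub : ∀ x k, S (treeCell S L R k D x) ⊆ S D := fun x k => h.treeCell_subset D x k
  have hgI : IntegrableOn g (S D) μ := hgi
  have hglim : Tendsto (fun k => ∫⁻ x in S D, ‖(⨍ y in S (treeCell S L R k D x), g y ∂μ) - g x‖ₑ ∂μ)
      atTop (nhds 0) := by
    rw [← lintegral_zero (μ := μ.restrict (S D))]
    refine tendsto_lintegral_of_dominated_convergence (fun _ => ENNReal.ofReal (C + C))
      (fun k => ?_) (fun k => Eventually.of_forall fun x => ?_) ?_ ?_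
    · exact ((measurable_treeCell hS (fun C => ⨍ y in S C, g y ∂μ) k D).sub hg.measurable).enorm
    · simp only
      rw [← ofReal_norm]
      refine ENNReal.ofReal_le_ofReal ((norm_sub_le _ _).trans (add_le_add ?_ (hC x)))
      have hmem := (convex_closedBall (0 : ℝ × ℝ) C).set_average_mem Metric.isClosed_closedBall
        (hμ0 (treeCell S L R k D x)) (hfin _)
        (Eventually.of_forall fun y => mem_closedBall_zero_iff.2 (hC y)) (hgI.mono_set (hsub x k))
      exact mem_closedBall_zero_iff.1 hmem
    · rw [lintegral_const]
      exact ENNReal.mul_ne_top ENNReal.ofReal_ne_top (measure_ne_top _ _)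
    · filter_upwards [hshrink] with x hx
      have := tendsto_setAverage_of_continuous (fun k => hS (treeCell S L R k D x))
        (fun k => hμ0 _) (fun k => hfin _) hx hg fun k => hgI.mono_set (hsub x k)
      have h0 := (this.sub_const (g x)).enorm
      simpa using h0
  filter_upwards [ENNReal.tendsto_nhds_zero.1 hglim (ε / 3) (pos_iff_ne_zero.2 hε3)] with k hk
  have hmeas1 : Measurable fun x => ‖⨍ y in S (treeCell S L R k D x), (f y - g y) ∂μ‖ₑ :=
    (measurable_treeCell hS (fun C => ⨍ y in S C, (f y - g y) ∂μ) k D).enorm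
  have hmeas2 : Measurable fun x => ‖(⨍ y in S (treeCell S L R k D x), g y ∂μ) - g x‖ₑ :=
    ((measurable_treeCell hS (fun C => ⨍ y in S C, g y ∂μ) k D).sub hg.measurable).enorm
  calc ∫⁻ x in S D, ‖(⨍ y in S (treeCell S L R k D x), f y ∂μ) - f x‖ₑ ∂μ
      ≤ ∫⁻ x in S D, (‖⨍ y in S (treeCell S L R k D x), (f y - g y) ∂μ‖ₑ +
          (‖(⨍ y in S (treeCell S L R k D x), g y ∂μ) - g x‖ₑ + ‖f x - g x‖ₑ)) ∂μ := by
        refine lintegral_mono fun x => ?_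
        have hdecomp : (⨍ y in S (treeCell S L R k D x), f y ∂μ) - f x =
            (⨍ y in S (treeCell S L R k D x), (f y - g y) ∂μ) +
            (((⨍ y in S (treeCell S L R k D x), g y ∂μ) - g x) - (f x - g x)) := by
          simp only [setAverage_eq]
          rw [integral_sub (hf.mono_set (hsub x k)) (hgI.mono_set (hsub x k)), smul_sub]
          abel
        simp only
        rw [hdecomp]
        exact (enorm_add_le _ _).trans (add_le_add_right enorm_sub_le _)
    _ = ∫⁻ x in S D, ‖⨍ y in S (treeCell S L R k D x), (f y - g y) ∂μ‖ₑ ∂μ +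
          (∫⁻ x in S D, ‖(⨍ y in S (treeCell S L R k D x), g y ∂μ) - g x‖ₑ ∂μ +
            ∫⁻ x in S D, ‖f x - g x‖ₑ ∂μ) := by
        rw [lintegral_add_left hmeas1, lintegral_add_left hmeas2]
    _ ≤ ε / 3 + (ε / 3 + ε / 3) :=
        add_le_add ((h.lintegral_enorm_average_treeCell_le hS hfin _ k D).trans hfg)
          (add_le_add hk hfg)
    _ = ε := by rw [← add_assoc]; exact ENNReal.add_thirds ε

/-- A nonnegative continuous function of the averages which decreases under averaging along the
splittings majorizes the average of its pointwise values. -/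
lemma lintegral_comp_le {n : ℕ} {G : Type*} {S : G → Set (Fin n → ℝ)} {L R : G → G}
    (h : IsSplitting S L R) (hS : ∀ D, MeasurableSet (S D)) {μ : Measure (Fin n → ℝ)}
    (hμ0 : ∀ D, μ (S D) ≠ 0) (hfin : ∀ D, μ (S D) ≠ ⊤) {D : G}
    (hshrink : ∀ᵐ x ∂μ.restrict (S D), ∀ U ∈ nhds x, ∀ᶠ k in atTop, S (treeCell S L R k D x) ⊆ U)
    {f : (Fin n → ℝ) → ℝ × ℝ} (hf : IntegrableOn f (S D) μ) {Ω : Set (ℝ × ℝ)} {B : ℝ × ℝ → ℝ}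
    (hB : ContinuousOn B Ω) (hfΩ : ∀ᵐ x ∂μ.restrict (S D), f x ∈ Ω)
    (havg : ∀ C, ⨍ x in S C, f x ∂μ ∈ Ω)
    (hsuper : ∀ C, μ (S (L C)) * ENNReal.ofReal (B (⨍ x in S (L C), f x ∂μ)) +
      μ (S (R C)) * ENNReal.ofReal (B (⨍ x in S (R C), f x ∂μ)) ≤
        μ (S C) * ENNReal.ofReal (B (⨍ x in S C, f x ∂μ))) :
    ∫⁻ x in S D, ENNReal.ofReal (B (f x)) ∂μ ≤
      μ (S D) * ENNReal.ofReal (B (⨍ x in S D, f x ∂μ)) := by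
  have hmeasure : TendstoInMeasure (μ.restrict (S D))
      (fun k x => ⨍ y in S (treeCell S L R k D x), f y ∂μ) atTop f := by
    refine tendstoInMeasure_of_tendsto_eLpNorm one_ne_zero (fun k => ?_) hf.aestronglyMeasurable ?_
    · exact (measurable_treeCell hS (fun C => ⨍ y in S C, f y ∂μ) k D).aestronglyMeasurable
    · simp only [eLpNorm_one_eq_lintegral_enorm, Pi.sub_apply]
      exact h.tendsto_lintegral_treeCell hS hμ0 hfin hshrink hf
  obtain ⟨ns, -, hns⟩ := hmeasure.exists_seq_tendsto_ae
  set F : ℕ → (Fin n → ℝ) → ENNReal := fun k x =>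
    ENNReal.ofReal (B (⨍ y in S (treeCell S L R (ns k) D x), f y ∂μ)) with hF
  calc ∫⁻ x in S D, ENNReal.ofReal (B (f x)) ∂μ
      ≤ ∫⁻ x in S D, liminf (fun k => F k x) atTop ∂μ := by
        refine lintegral_mono_ae ?_
        filter_upwards [hns, hfΩ] with x hx hxΩ
        refine le_of_eq (Tendsto.liminf_eq ?_).symm
        refine ENNReal.tendsto_ofReal ((hB _ hxΩ).tendsto.comp ?_)
        exact tendsto_nhdsWithin_iff.2 ⟨hx, Eventually.of_forall fun k => havg _⟩
    _ ≤ liminf (fun k => ∫⁻ x in S D, F k x ∂μ) atTop := lintegral_liminf_le fun k =>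
        measurable_treeCell hS (fun C => ENNReal.ofReal (B (⨍ y in S C, f y ∂μ))) (ns k) D
    _ ≤ liminf (fun _ : ℕ => μ (S D) * ENNReal.ofReal (B (⨍ x in S D, f x ∂μ))) atTop :=
        liminf_le_liminf (Eventually.of_forall fun k => h.lintegral_treeCell_le hS
          (ψ := fun C => ENNReal.ofReal (B (⨍ x in S C, f x ∂μ))) hsuper (ns k) D)
    _ = _ := liminf_const _

end IsSplitting

/-- Successive splitting of a longest side of a box either shrinks the boxes to a point, or their
intersection has nonempty interior, so that it contains a rational point. -/
lemma tendsto_zero_or_exists_rat_mem {n : ℕ} {a b : ℕ → Fin n → ℝ} (hab : ∀ k i, a k i < b k i)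
    (hstep : ∀ k, ∃ i, ∃ t ∈ Ioo (a k i) (b k i), (∀ j, b k j - a k j ≤ b k i - a k i) ∧
      (a (k + 1) = a k ∧ b (k + 1) = Function.update (b k) i t ∨
        a (k + 1) = Function.update (a k) i t ∧ b (k + 1) = b k)) :
    (∀ i, Tendsto (fun k => b k i - a k i) atTop (nhds 0)) ∨
      ∃ y : Fin n → ℚ, ∀ k, (fun i => (y i : ℝ)) ∈ halfOpenBox (a k) (b k) := by
  have hmono : ∀ j, Monotone fun k => a k j := fun j => monotone_nat_of_le_succ fun k => by
    obtain ⟨i, t, ht, -, ⟨h1, -⟩ | ⟨h1, -⟩⟩ := hstep k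
    · rw [h1]
    · rw [h1]
      rcases eq_or_ne j i with rfl | hj
      · simpa using ht.1.le
      · simp [hj]
  have hanti : ∀ j, Antitone fun k => b k j := fun j => antitone_nat_of_succ_le fun k => by
    obtain ⟨i, t, ht, -, ⟨-, h1⟩ | ⟨-, h1⟩⟩ := hstep k
    · rw [h1]
      rcases eq_or_ne j i with rfl | hj
      · simpa using ht.2.le
      · simp [hj]
    · rw [h1]
  have hle : ∀ j k l, a k j < b l j := fun j k l =>
    ((hmono j (le_max_left k l)).trans_lt (hab _ j)).trans_le (hanti j (le_max_right k l))
  have hbdda : ∀ j, BddAbove (range fun k => a k j) := fun j =>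
    ⟨b 0 j, by rintro _ ⟨k, rfl⟩; exact (hle j k 0).le⟩
  have hbddb : ∀ j, BddBelow (range fun k => b k j) := fun j =>
    ⟨a 0 j, by rintro _ ⟨k, rfl⟩; exact (hle j 0 k).le⟩
  set α : Fin n → ℝ := fun j => ⨆ k, a k j with hα
  set β : Fin n → ℝ := fun j => ⨅ k, b k j with hβ
  have hαlim : ∀ j, Tendsto (fun k => a k j) atTop (nhds (α j)) := fun j =>
    tendsto_atTop_ciSup (hmono j) (hbdda j)
  have hβlim : ∀ j, Tendsto (fun k => b k j) atTop (nhds (β j)) := fun j =>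
    tendsto_atTop_ciInf (hanti j) (hbddb j)
  have haα : ∀ j k, a k j ≤ α j := fun j k => le_ciSup (hbdda j) k
  have hbβ : ∀ j k, β j ≤ b k j := fun j k => ciInf_le (hbddb j) k
  have hαβ : ∀ j, α j ≤ β j := fun j => ciSup_le fun k => le_ciInf fun l => (hle j k l).le
  have hlim : ∀ j, Tendsto (fun k => b k j - a k j) atTop (nhds (β j - α j)) := fun j =>
    (hβlim j).sub (hαlim j)
  by_cases hall : ∀ j, β j - α j = 0
  · exact Or.inl fun j => hall j ▸ hlim j
  · right
    push Not at hall
    obtain ⟨i₀, hi₀⟩ := hall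
    have hi₀ : 0 < β i₀ - α i₀ := lt_of_le_of_ne (sub_nonneg.2 (hαβ i₀)) hi₀.symm
    have hpos : ∀ j, α j < β j := by
      intro j
      refine lt_of_le_of_ne (hαβ j) fun h0 => ?_
      have hj := hlim j
      rw [h0, sub_self] at hj
      obtain ⟨K, hK⟩ := eventually_atTop.1 (hj.eventually (gt_mem_nhds hi₀))
      have hconst : ∀ k ≥ K, b k j - a k j = b K j - a K j := by
        intro k hk
        induction k, hk using Nat.le_induction with
        | base => rfl
        | succ k hk ih =>
          rw [← ih]
          obtain ⟨i, t, ht, hlong, hchild⟩ := hstep k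
          have hne : j ≠ i := by
            rintro rfl
            have h1 := hK k hk
            have h2 := hlong i₀
            have h3 := haα i₀ k
            have h4 := hbβ i₀ k
            linarith
          rcases hchild with ⟨h1, h2⟩ | ⟨h1, h2⟩ <;> rw [h1, h2] <;> simp [hne]
      have hlim' : Tendsto (fun k => b k j - a k j) atTop (nhds (b K j - a K j)) :=
        tendsto_const_nhds.congr' (by
          filter_upwards [eventually_ge_atTop K] with k hk using (hconst k hk).symm)
      have := tendsto_nhds_unique hj hlim'
      linarith [hab K j]
    choose y hy using fun j => exists_rat_btwn (hpos j)
    exact ⟨y, fun k => mem_halfOpenBox.2 fun j =>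
      ⟨(haα j k).trans_lt (hy j).1, (hy j).2.le.trans (hbβ j k)⟩⟩

lemma eventually_halfOpenBox_subset {n : ℕ} {a b : ℕ → Fin n → ℝ} {x : Fin n → ℝ}
    (hx : ∀ k, x ∈ halfOpenBox (a k) (b k))
    (hlim : ∀ i, Tendsto (fun k => b k i - a k i) atTop (nhds 0)) {U : Set (Fin n → ℝ)}
    (hU : U ∈ nhds x) : ∀ᶠ k in atTop, halfOpenBox (a k) (b k) ⊆ U := by
  obtain ⟨ε, hε, hεU⟩ := Metric.mem_nhds_iff.1 hU
  have hall : ∀ᶠ k in atTop, ∀ i, b k i - a k i < ε :=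
    eventually_all.2 fun i => (hlim i).eventually (gt_mem_nhds hε)
  filter_upwards [hall] with k hk y hy
  refine hεU ((dist_pi_lt_iff hε).2 fun i => ?_)
  have h1 := mem_halfOpenBox.1 (hx k) i
  have h2 := mem_halfOpenBox.1 hy i
  rw [Real.dist_eq, abs_lt]
  constructor <;> linarith [hk i]

/-- If every cell is a box split across a longest side into two boxes of comparable measure, then
the cells shrink to points almost everywhere. -/
lemma ae_forall_nhds_eventually_treeCell_subset {n : ℕ} {μ : Measure (Fin n → ℝ)} {G : Type*}
    {lo hi : G → Fin n → ℝ} (hlohi : ∀ D i, lo D i < hi D i) {L R : G → G}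
    (h : IsSplitting (fun D => halfOpenBox (lo D) (hi D)) L R)
    (hchild : ∀ D, ∃ i, ∃ t ∈ Ioo (lo D i) (hi D i), (∀ j, hi D j - lo D j ≤ hi D i - lo D i) ∧
      (lo (L D) = lo D ∧ hi (L D) = Function.update (hi D) i t) ∧
      (lo (R D) = Function.update (lo D) i t ∧ hi (R D) = hi D))
    {c : ENNReal} (hc : c < 1)
    (hL : ∀ D, μ (halfOpenBox (lo (L D)) (hi (L D))) ≤ c * μ (halfOpenBox (lo D) (hi D)))
    (hR : ∀ D, μ (halfOpenBox (lo (R D)) (hi (R D))) ≤ c * μ (halfOpenBox (lo D) (hi D)))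
    (D : G) (hD : μ (halfOpenBox (lo D) (hi D)) ≠ ⊤) :
    ∀ᵐ x ∂μ.restrict (halfOpenBox (lo D) (hi D)), ∀ U ∈ nhds x, ∀ᶠ k in atTop,
      (fun D => halfOpenBox (lo D) (hi D))
        (treeCell (fun D => halfOpenBox (lo D) (hi D)) L R k D x) ⊆ U := by
  set S : G → Set (Fin n → ℝ) := fun D => halfOpenBox (lo D) (hi D) with hS
  have hnull : ∀ y : Fin n → ℚ, μ (⋂ k, S (treeCell S L R k D fun i => (y i : ℝ))) = 0 := by
    intro y
    have hlim : Tendsto (fun k : ℕ => c ^ k * μ (S D)) atTop (nhds 0) := by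
      have := ENNReal.Tendsto.mul_const (ENNReal.tendsto_pow_atTop_nhds_zero_of_lt_one hc)
        (Or.inr hD)
      simpa using this
    refine le_antisymm (ge_of_tendsto' hlim fun k => ?_) zero_le
    exact (measure_mono (iInter_subset _ k)).trans (IsSplitting.measure_treeCell_le hL hR D _ k)
  have hae : ∀ᵐ x ∂μ, ∀ y : Fin n → ℚ, x ∉ ⋂ k, S (treeCell S L R k D fun i => (y i : ℝ)) :=
    ae_all_iff.2 fun y => measure_eq_zero_iff_ae_notMem.1 (hnull y)
  filter_upwards [ae_restrict_of_ae hae,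
    ae_restrict_mem (measurableSet_halfOpenBox (lo D) (hi D))] with x hx hxD U hU
  have hmem := h.mem_treeCell hxD
  rcases tendsto_zero_or_exists_rat_mem (a := fun k => lo (treeCell S L R k D x))
    (b := fun k => hi (treeCell S L R k D x)) (fun k => hlohi _) (fun k => by
      obtain ⟨i, t, ht, hlong, hl, hr⟩ := hchild (treeCell S L R k D x)
      refine ⟨i, t, ht, hlong, ?_⟩
      rw [treeCell_succ', treeStep]
      split_ifs
      · exact Or.inl hl
      · exact Or.inr hr) with hlim | ⟨y, hy⟩
  · exact eventually_halfOpenBox_subset hmem hlim hU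
  · refine absurd (mem_iInter.2 fun k => ?_) (hx y)
    rw [h.treeCell_eq_of_mem (hy k)]
    exact hmem k

lemma lintegral_bellman_le {n : ℕ} (hn : 1 ≤ n) {μ : Measure (Fin n → ℝ)}
    [IsLocallyFiniteMeasure μ] (hnull : NullHyperplanes μ) {f : (Fin n → ℝ) → ℝ × ℝ} {q Q Q₁ : ℝ}
    (hq : 0 ≤ q) (hQ₁ : 0 < Q₁) (hQ : Q < Q₁) {B : ℝ × ℝ → ℝ}
    (hB0 : ∀ x ∈ bellmanDomain q Q₁, 0 ≤ B x) (hBcont : ContinuousOn B (bellmanDomain q Q₁))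
    (hBconc : ∀ x y : ℝ × ℝ, segment ℝ x y ⊆ bellmanDomain q Q₁ → ∀ l ∈ Icc (0 : ℝ) 1,
      l * B x + (1 - l) * B y ≤ B (l • x + (1 - l) • y))
    (hf : ∀ a b : Fin n → ℝ, (∀ i, a i < b i) → μ (halfOpenBox a b) ≠ 0 →
      IntegrableOn f (halfOpenBox a b) μ ∧
        ⨍ x in halfOpenBox a b, f x ∂μ ∈ bellmanDomain q Q)
    (hfΩ : ∀ᵐ x ∂μ, f x ∈ bellmanDomain q Q₁)
    {a b : Fin n → ℝ} (hab : ∀ i, a i < b i) (hμ : μ (halfOpenBox a b) ≠ 0) :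
    ∫⁻ x in halfOpenBox a b, ENNReal.ofReal (B (f x)) ∂μ ≤
      μ (halfOpenBox a b) * ENNReal.ofReal (B (⨍ x in halfOpenBox a b, f x ∂μ)) := by
  have : Nonempty (Fin n) := ⟨⟨0, hn⟩⟩
  obtain ⟨δ, hδ0, hδ1, hδ⟩ := exists_splitting_ratio (q := q) hQ
  let G := {D : (Fin n → ℝ) × (Fin n → ℝ) //
    (∀ i, D.1 i < D.2 i) ∧ μ (halfOpenBox D.1 D.2) ≠ 0}
  have hsplit : ∀ D : G, ∃ i, ∃ t ∈ Ioo (D.1.1 i) (D.1.2 i),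
      (∀ j, D.1.2 j - D.1.1 j ≤ D.1.2 i - D.1.1 i) ∧
      μ.real (halfOpenBox D.1.1 (Function.update D.1.2 i t)) ∈
        Icc (δ * μ.real (halfOpenBox D.1.1 D.1.2)) ((1 - δ) * μ.real (halfOpenBox D.1.1 D.1.2)) ∧
      segment ℝ (⨍ x in halfOpenBox D.1.1 (Function.update D.1.2 i t), f x ∂μ)
        (⨍ x in halfOpenBox (Function.update D.1.1 i t) D.1.2, f x ∂μ) ⊆ bellmanDomain q Q₁ := by
    intro D
    obtain ⟨i, hi⟩ := Finite.exists_max fun i => D.1.2 i - D.1.1 i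
    obtain ⟨t, ht, h1, h2⟩ :=
      exists_split hnull hq hQ₁ hQ.le hδ0 hδ1 hδ hf D.2.1 D.2.2 i
    exact ⟨i, t, ht, hi, h1, h2⟩
  choose i t ht hlong hmass hseg using hsplit
  set m : G → ℝ := fun D => μ.real (halfOpenBox D.1.1 D.1.2) with hm
  have hmpos : ∀ D, 0 < m D := fun D => ENNReal.toReal_pos D.2.2 (measure_halfOpenBox_ne_top _ _)
  have hsum : ∀ D : G, μ.real (halfOpenBox D.1.1 (Function.update D.1.2 (i D) (t D))) +
      μ.real (halfOpenBox (Function.update D.1.1 (i D) (t D)) D.1.2) = m D := fun D => by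
    rw [hm, ← measureReal_union disjoint_halfOpenBox_update (measurableSet_halfOpenBox _ _)
      (measure_halfOpenBox_ne_top _ _) (measure_halfOpenBox_ne_top _ _),
      halfOpenBox_update_union (Ioo_subset_Icc_self (ht D))]
  let L : G → G := fun D => ⟨(D.1.1, Function.update D.1.2 (i D) (t D)), fun j => by
      rcases eq_or_ne j (i D) with rfl | hj
      · simpa using (ht D).1
      · simpa [hj] using D.2.1 j, fun h0 => by
      have h1 := (hmass D).1
      have h2 := mul_pos hδ0 (hmpos D)
      simp only [measureReal_def, h0, ENNReal.toReal_zero] at h1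
      simp only [hm, measureReal_def] at h2
      linarith⟩
  let R : G → G := fun D => ⟨(Function.update D.1.1 (i D) (t D), D.1.2), fun j => by
      rcases eq_or_ne j (i D) with rfl | hj
      · simpa using (ht D).2
      · simpa [hj] using D.2.1 j, fun h0 => by
      have h1 := (hmass D).2
      have h2 := mul_pos hδ0 (hmpos D)
      have h3 := hsum D
      rw [measureReal_def, measureReal_def, h0, ENNReal.toReal_zero, ← measureReal_def] at h3
      simp only [hm] at h2 h3
      linarith⟩
  have hsumLR : ∀ D, m (L D) + m (R D) = m D := hsum
  have hLm : ∀ D, m (L D) ≤ (1 - δ) * m D := fun D => (hmass D).2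
  have hRm : ∀ D, m (R D) ≤ (1 - δ) * m D := fun D => by
    have h1 : δ * m D ≤ m (L D) := (hmass D).1
    linarith [hsumLR D]
  have hmeasure : ∀ D : G, μ (halfOpenBox D.1.1 D.1.2) = ENNReal.ofReal (m D) := fun D =>
    (ofReal_measureReal (measure_halfOpenBox_ne_top _ _)).symm
  have hscale : ∀ {C D : G}, m C ≤ (1 - δ) * m D → μ (halfOpenBox C.1.1 C.1.2) ≤
      ENNReal.ofReal (1 - δ) * μ (halfOpenBox D.1.1 D.1.2) := fun {C D} h => by
    rw [hmeasure, hmeasure, ← ENNReal.ofReal_mul (by linarith)]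
    exact ENNReal.ofReal_le_ofReal h
  have hS : IsSplitting (fun D : G => halfOpenBox D.1.1 D.1.2) L R :=
    ⟨fun D => halfOpenBox_update_union (Ioo_subset_Icc_self (ht D)),
      fun D => disjoint_halfOpenBox_update⟩
  have hmemQ : ∀ D : G, ⨍ x in halfOpenBox D.1.1 D.1.2, f x ∂μ ∈ bellmanDomain q Q₁ := fun D => by
    obtain ⟨h1, h2, h3, h4⟩ := (hf D.1.1 D.1.2 D.2.1 D.2.2).2
    exact ⟨h1, h2, h3, h4.trans hQ.le⟩
  refine hS.lintegral_comp_le (D := ⟨(a, b), hab, hμ⟩) (fun D => measurableSet_halfOpenBox _ _)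
    (fun D => D.2.2) (fun D => measure_halfOpenBox_ne_top _ _) ?_ (hf a b hab hμ).1 hBcont
    (ae_restrict_of_ae hfΩ) hmemQ fun D => ?_
  · exact ae_forall_nhds_eventually_treeCell_subset (lo := fun D : G => D.1.1)
      (hi := fun D : G => D.1.2) (fun D => D.2.1) hS
      (fun D => ⟨i D, t D, ht D, hlong D, ⟨rfl, rfl⟩, rfl, rfl⟩)
      (c := ENNReal.ofReal (1 - δ)) (by rw [ENNReal.ofReal_lt_one]; linarith)
      (fun D => hscale (hLm D)) (fun D => hscale (hRm D)) _ (measure_halfOpenBox_ne_top _ _)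
  · simp only [hmeasure]
    have hL0 := hB0 _ (hmemQ (L D))
    have hR0 := hB0 _ (hmemQ (R D))
    rw [← ENNReal.ofReal_mul (hmpos _).le, ← ENNReal.ofReal_mul (hmpos _).le,
      ← ENNReal.ofReal_mul (hmpos _).le,
      ← ENNReal.ofReal_add (mul_nonneg (hmpos _).le hL0) (mul_nonneg (hmpos _).le hR0)]
    refine ENNReal.ofReal_le_ofReal ?_
    have hadd := measureReal_smul_setAverage_union (hS.union D) (hS.disjoint D)
      (measurableSet_halfOpenBox _ _) (measure_halfOpenBox_ne_top _ _) (hf _ _ D.2.1 D.2.2).1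
    have hratio : 1 - m (L D) / m D = m (R D) / m D := by
      rw [eq_div_iff (hmpos D).ne', sub_mul, div_mul_cancel₀ _ (hmpos D).ne']
      linarith [hsumLR D]
    have hconc := hBconc _ _ (hseg D) (m (L D) / m D)
      ⟨div_nonneg (hmpos _).le (hmpos _).le, (div_le_one (hmpos D)).2
        (by linarith [hsumLR D, hmpos (R D)])⟩
    have hpoint : (m (L D) / m D) • (⨍ x in halfOpenBox (L D).1.1 (L D).1.2, f x ∂μ) +
        (m (R D) / m D) • (⨍ x in halfOpenBox (R D).1.1 (R D).1.2, f x ∂μ) =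
        ⨍ x in halfOpenBox D.1.1 D.1.2, f x ∂μ := by
      rw [div_eq_inv_mul, div_eq_inv_mul, mul_smul, mul_smul, ← smul_add]
      exact (congrArg _ hadd).trans (inv_smul_smul₀ (hmpos D).ne' _)
    rw [hratio] at hconc
    have hconc' := hconc.trans_eq (congrArg B hpoint)
    rw [div_mul_eq_mul_div, div_mul_eq_mul_div, ← add_div, div_le_iff₀' (hmpos D)] at hconc'
    exact hconc'

lemma mul_rpow_rpow_neg_one_div {p x : ℝ} (hp : 1 < p) (hx : 0 < x) :
    x * (x ^ (-1 / (p - 1))) ^ (p - 1) = 1 := by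
  rw [← Real.rpow_mul hx.le, div_mul_cancel₀ _ (by linarith : p - 1 ≠ 0), Real.rpow_neg_one,
    mul_inv_cancel₀ hx.ne']

/-- The pair of averages of `w` and `w^{-1/(p-1)}` lies in the domain of the Bellman function. -/
lemma setAverage_mem_bellmanDomain {n : ℕ} {μ : Measure (Fin n → ℝ)} [IsLocallyFiniteMeasure μ]
    (hnull : NullHyperplanes μ) {w : (Fin n → ℝ) → ℝ} {p Q : ℝ} (hp : 1 < p)
    (hw : ∀ᵐ x ∂μ, 0 < w x) (hA : ApBound μ w p Q) {a b : Fin n → ℝ} (hab : ∀ i, a i < b i)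
    (hμ : μ (halfOpenBox a b) ≠ 0) :
    IntegrableOn (fun x => (w x, w x ^ (-1 / (p - 1)))) (halfOpenBox a b) μ ∧
      ⨍ x in halfOpenBox a b, (w x, w x ^ (-1 / (p - 1))) ∂μ =
        (boxAvg μ (univ.pi fun i => Ioo (a i) (b i)) w,
          boxAvg μ (univ.pi fun i => Ioo (a i) (b i)) fun x => w x ^ (-1 / (p - 1))) ∧
      ⨍ x in halfOpenBox a b, (w x, w x ^ (-1 / (p - 1))) ∂μ ∈ bellmanDomain (p - 1) Q := by
  have hae := halfOpenBox_ae_eq hnull a b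
  have htop : μ (halfOpenBox a b) ≠ ⊤ := measure_halfOpenBox_ne_top a b
  have hmeas := measure_congr hae
  obtain ⟨h1, h2, h3⟩ := hA _ ⟨a, b, hab, rfl⟩ (by rw [hmeas]; exact pos_iff_ne_zero.2 hμ)
    (by rw [hmeas]; exact htop.lt_top)
  have hint : IntegrableOn (fun x => (w x, w x ^ (-1 / (p - 1)))) (halfOpenBox a b) μ :=
    (h1.congr_set_ae hae.symm).prodMk (h2.congr_set_ae hae.symm)
  have hpair : ⨍ x in halfOpenBox a b, (w x, w x ^ (-1 / (p - 1))) ∂μ =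
        (boxAvg μ (univ.pi fun i => Ioo (a i) (b i)) w,
          boxAvg μ (univ.pi fun i => Ioo (a i) (b i)) fun x => w x ^ (-1 / (p - 1))) := by
    simp only [boxAvg]
    rw [setAverage_congr hae, setAverage_congr hae]
    simp only [setAverage_eq]
    refine Prod.ext ?_ ?_
    · rw [Prod.smul_fst, fst_integral hint]
    · rw [Prod.smul_snd, snd_integral hint]
  refine ⟨hint, hpair, ?_⟩
  have hmem := (convex_le_mul_rpow (q := p - 1) (by linarith) one_pos).set_average_mem
    (isClosed_le_mul_rpow (by linarith) one_pos) hμ htop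
    (ae_restrict_of_ae (hw.mono fun x hx =>
      ⟨hx, Real.rpow_pos_of_pos hx _, (mul_rpow_rpow_neg_one_div hp hx).ge⟩)) hint
  refine ⟨hmem.1, hmem.2.1, hmem.2.2, ?_⟩
  rw [hpair]
  exact h3

/-- A Bellman function (continuous, nonnegative, concave along segments
of `Ω_{Q₁}`, majorizing `x₁^r` on the lower boundary) majorizes the `r`-average: for every
weight with `[w]_p ≤ Q < Q₁` and every box `R`, `⟨w^r⟩_R ≤ B(⟨w⟩_R, ⟨w^{p1}⟩_R)`. -/
theorem bellman_majorizes_average_Ap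
    (p p1 r Q Q₁ : ℝ) (hp : 1 < p) (hp1 : p1 = -1 / (p - 1)) (hQ : 1 < Q) (hQ₁ : Q < Q₁)
    (Ω : Set (ℝ × ℝ))
    (hΩ : Ω = {x : ℝ × ℝ | 0 < x.1 ∧ 0 < x.2 ∧
      1 ≤ x.1 * x.2 ^ (p - 1) ∧ x.1 * x.2 ^ (p - 1) ≤ Q₁})
    (B : ℝ × ℝ → ℝ)
    (hB0 : ∀ x ∈ Ω, 0 ≤ B x)
    (hBcont : ContinuousOn B Ω)
    (hBconc : ∀ x y : ℝ × ℝ, segment ℝ x y ⊆ Ω → ∀ l ∈ Icc (0:ℝ) 1,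
      l * B x + (1 - l) * B y ≤ B (l • x + (1 - l) • y))
    (hBbdry : ∀ x1 : ℝ, 0 < x1 → x1 ^ r ≤ B (x1, x1 ^ p1)) :
    ∀ n : ℕ, 1 ≤ n →
      ∀ μ : Measure (Fin n → ℝ), IsLocallyFiniteMeasure μ → NullHyperplanes μ →
        ∀ w : (Fin n → ℝ) → ℝ, Measurable w → (∀ᵐ x ∂μ, 0 < w x) →
          ApBound μ w p Q →
          LocallyIntegrable (fun x => w x ^ r) μ →
          ∀ R : Set (Fin n → ℝ), IsBox R → 0 < μ R → μ R < ⊤ →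
            boxAvg μ R (fun x => w x ^ r) ≤
              B (boxAvg μ R w, boxAvg μ R fun x => w x ^ p1) := by
  subst hΩ hp1
  rintro n hn μ hμfin hnull w hw hwpos hA - _ ⟨a, b, hab, rfl⟩ hR0 -
  have hae := halfOpenBox_ae_eq hnull a b
  have hμ : μ (halfOpenBox a b) ≠ 0 := by rw [← measure_congr hae]; exact hR0.ne'
  obtain ⟨-, hpair, hmem⟩ := setAverage_mem_bellmanDomain hnull hp hwpos hA hab hμ
  have hmain := lintegral_bellman_le hn hnull (f := fun x => (w x, w x ^ (-1 / (p - 1))))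
    (q := p - 1) (by linarith) (by linarith) hQ₁ hB0 hBcont hBconc
    (fun a b hab hμ => ⟨(setAverage_mem_bellmanDomain hnull hp hwpos hA hab hμ).1,
      (setAverage_mem_bellmanDomain hnull hp hwpos hA hab hμ).2.2⟩)
    (hwpos.mono fun x hx => ⟨hx, Real.rpow_pos_of_pos hx _,
      (mul_rpow_rpow_neg_one_div hp hx).ge, by
        rw [mul_rpow_rpow_neg_one_div hp hx]; linarith⟩) hab hμ
  have hB : 0 ≤ B (⨍ x in halfOpenBox a b, (w x, w x ^ (-1 / (p - 1))) ∂μ) :=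
    hB0 _ ⟨hmem.1, hmem.2.1, hmem.2.2.1, hmem.2.2.2.trans hQ₁.le⟩
  have hmpos : 0 < μ.real (halfOpenBox a b) :=
    ENNReal.toReal_pos hμ (measure_halfOpenBox_ne_top _ _)
  have hle : ∫⁻ x in halfOpenBox a b, ENNReal.ofReal (w x ^ r) ∂μ ≤ μ (halfOpenBox a b) *
      ENNReal.ofReal (B (⨍ x in halfOpenBox a b, (w x, w x ^ (-1 / (p - 1))) ∂μ)) :=
    (lintegral_mono_ae (ae_restrict_of_ae (hwpos.mono fun x hx =>
      ENNReal.ofReal_le_ofReal (hBbdry _ hx)))).trans hmain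
  rw [← hpair, boxAvg, setAverage_congr hae, setAverage_eq, smul_eq_mul, inv_mul_le_iff₀ hmpos,
    integral_eq_lintegral_of_nonneg_ae
      (ae_restrict_of_ae (hwpos.mono fun x hx => Real.rpow_nonneg hx.le r))
      (hw.pow_const r).aestronglyMeasurable]
  refine (ENNReal.toReal_mono (ENNReal.mul_ne_top (measure_halfOpenBox_ne_top _ _)
    ENNReal.ofReal_ne_top) hle).trans_eq ?_
  rw [ENNReal.toReal_mul, ENNReal.toReal_ofReal hB, measureReal_def]
end
end

section
/- (Bellman function majorizes the r-average; RH_p case.) Let p > 1, r ∈ ℝ, and Q₁ > Q > 1. Let Ω_{Q₁} := {(x₁,x₂) ∈ ℝ² : x₁,x₂ > 0, 1 ≤ x₂^{1/p} · x₁^{-1} ≤ Q₁}, and let B : Ω_{Q₁} → [0,∞) be continuous and concave along every line segment contained in Ω_{Q₁}, with B(x₁, x₁^{p}) ≥ x₁^r for all x₁ > 0. Then for every n ≥ 1, every Radon measure μ on ℝⁿ with μ(H) = 0 for every hyperplane H orthogonal to a coordinate axis, every weight w with [w]_{RH_p} ≤ Q such that w^r is locally μ-integrable, and every axis-parallel rectangular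 box R with 0 < μ(R) < ∞, one has ⟨w^r⟩_R ≤ B(⟨w⟩_R, ⟨w^{p}⟩_R). -/
open MeasureTheory Set Filter

noncomputable section

/-- The closed region below the curve `x₂ = (Q x₁)^p`. -/
def belowCurve (p Q : ℝ) : Set (ℝ × ℝ) := {y | y.2 ≤ (Q * y.1) ^ p}

/-- The part of the epigraph of `x ↦ x^p` over the positive half-line. -/
def powEpigraph (p : ℝ) : Set (ℝ × ℝ) := {y | 0 < y.1 ∧ y.1 ^ p ≤ y.2}

lemma isClosed_belowCurve {p : ℝ} (hp : 0 ≤ p) (Q : ℝ) : IsClosed (belowCurve p Q) :=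
  isClosed_le continuous_snd ((continuous_const.mul continuous_fst).rpow_const fun _ => Or.inr hp)

lemma convex_powEpigraph {p : ℝ} (hp : 1 ≤ p) : Convex ℝ (powEpigraph p) :=
  ((convexOn_rpow hp).subset Ioi_subset_Ici_self (convex_Ioi 0)).convex_epigraph

/-- Membership in the region between the two power curves, freed of the root. -/
lemma mem_region_iff {p Q : ℝ} (hp : 0 < p) (hQ : 0 ≤ Q) (x : ℝ × ℝ) :
    (0 < x.1 ∧ 0 < x.2 ∧ 1 ≤ x.2 ^ (1 / p) * x.1⁻¹ ∧ x.2 ^ (1 / p) * x.1⁻¹ ≤ Q) ↔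
      x ∈ powEpigraph p ∩ belowCurve p Q := by
  have key : ∀ a b : ℝ, 0 ≤ a → 0 ≤ b → (a ^ (1 / p) ≤ b ↔ a ≤ b ^ p) := fun a b ha hb => by
    rw [one_div, Real.rpow_inv_le_iff_of_pos ha hb hp]
  have key' : ∀ a b : ℝ, 0 ≤ a → 0 ≤ b → (b ≤ a ^ (1 / p) ↔ b ^ p ≤ a) := fun a b ha hb => by
    rw [one_div, Real.le_rpow_inv_iff_of_pos hb ha hp]
  simp only [powEpigraph, belowCurve, mem_inter_iff, mem_ofPred_eq, ← div_eq_mul_inv]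
  constructor
  · rintro ⟨h1, h2, h3, h4⟩
    rw [one_le_div h1, key' _ _ h2.le h1.le] at h3
    rw [div_le_iff₀ h1, key _ _ h2.le (by positivity)] at h4
    exact ⟨⟨h1, h3⟩, h4⟩
  · rintro ⟨⟨h1, h3⟩, h4⟩
    have h2 : 0 < x.2 := (Real.rpow_pos_of_pos h1 p).trans_le h3
    rw [one_le_div h1, key' _ _ h2.le h1.le, div_le_iff₀ h1, key _ _ h2.le (by positivity)]
    exact ⟨h1, h2, h3, h4⟩

/-- If one of the two masses is a small enough `δ`, then the segment joining the barycentre to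
the heavy end stays below the enlarged curve. -/
lemma exists_segment_subset_belowCurve {p Q Q₁ : ℝ} (hp : 1 < p) (hQ : 1 < Q) (hQ₁ : Q < Q₁) :
    ∃ δ : ℝ, 0 < δ ∧ δ < 1 / 2 ∧ ∀ x y z : ℝ × ℝ, y ∈ powEpigraph p → z ∈ powEpigraph p →
      x = δ • y + (1 - δ) • z → x ∈ belowCurve p Q → segment ℝ x z ⊆ belowCurve p Q₁ := by
  have hp0 : 0 < p := by linarith
  have he : 0 < 1 - 1 / p := by
    rw [sub_pos, div_lt_one hp0]; exact hp
  have hlim : Tendsto (fun δ : ℝ => (Q₁ * (1 - Q * δ ^ (1 - 1 / p))) ^ p * (1 - δ))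
      (nhdsWithin 0 (Ioi 0)) (nhds ((Q₁ * (1 - Q * (0 : ℝ) ^ (1 - 1 / p))) ^ p * (1 - 0))) := by
    apply Tendsto.mono_left _ nhdsWithin_le_nhds
    apply Continuous.tendsto
    refine ((continuous_const.mul (continuous_const.sub (continuous_const.mul
      (continuous_id.rpow_const fun _ => Or.inr he.le)))).rpow_const
        fun _ => Or.inr hp0.le).mul (continuous_const.sub continuous_id)
  have hlim2 : Tendsto (fun δ : ℝ => 1 - Q * δ ^ (1 - 1 / p))
      (nhdsWithin 0 (Ioi 0)) (nhds (1 - Q * (0 : ℝ) ^ (1 - 1 / p))) := by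
    apply Tendsto.mono_left _ nhdsWithin_le_nhds
    apply Continuous.tendsto
    exact continuous_const.sub (continuous_const.mul
      (continuous_id.rpow_const fun _ => Or.inr he.le))
  rw [Real.zero_rpow he.ne'] at hlim hlim2
  simp only [mul_zero, sub_zero, mul_one] at hlim hlim2
  have hQQ : Q ^ p < Q₁ ^ p := Real.rpow_lt_rpow (by linarith) hQ₁ hp0
  obtain ⟨δ, ⟨h1, h2⟩, h3⟩ := (((hlim.eventually (lt_mem_nhds hQQ)).and
    (hlim2.eventually (lt_mem_nhds one_pos))).and
    (Ioo_mem_nhdsGT (show (0 : ℝ) < 1 / 2 by norm_num))).exists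
  refine ⟨δ, h3.1, h3.2, ?_⟩
  rintro x y z ⟨hy1, hy2⟩ ⟨hz1, hz2⟩ hx hxQ u ⟨s, t, hs, ht, hst, rfl⟩
  have hδ := h3.1
  have hδ' := h3.2
  have hx1 : x.1 = δ * y.1 + (1 - δ) * z.1 := by rw [hx]; simp
  have hx2 : x.2 = δ * y.2 + (1 - δ) * z.2 := by rw [hx]; simp
  have hx1p : 0 < x.1 := by rw [hx1]; have : 0 < 1 - δ := by linarith
                            positivity
  have hy2p : 0 < y.2 := (Real.rpow_pos_of_pos hy1 p).trans_le hy2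
  have hz2p : 0 < z.2 := (Real.rpow_pos_of_pos hz1 p).trans_le hz2
  have hxQ' : x.2 ≤ (Q * x.1) ^ p := hxQ
  set ε := Q * δ ^ (1 - 1 / p) with hε
  have hε0 : 0 ≤ ε := by positivity
  have hyx : δ * y.1 ≤ ε * x.1 := by
    rw [← Real.rpow_le_rpow_iff (z := p) (by positivity) (by positivity) hp0]
    calc (δ * y.1) ^ p = δ ^ p * y.1 ^ p := Real.mul_rpow hδ.le hy1.le
      _ ≤ δ ^ p * y.2 := by gcongr
      _ = δ ^ (p - 1) * (δ * y.2) := by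
        rw [Real.rpow_sub_one hδ.ne']; field_simp
      _ ≤ δ ^ (p - 1) * (Q * x.1) ^ p := by
        gcongr; nlinarith
      _ = (ε * x.1) ^ p := by
        rw [hε, mul_right_comm, Real.mul_rpow (by positivity) (by positivity) (x := Q * x.1),
          ← Real.rpow_mul hδ.le, mul_comm]
        congr 2
        field_simp
  have hzx : (1 - ε) * x.1 ≤ z.1 := by nlinarith
  have hz2' : (1 - δ) * z.2 ≤ (Q * x.1) ^ p := by nlinarith
  have h1δ : 0 < 1 - δ := by linarith
  change (s • x + t • z).2 ≤ (Q₁ * (s • x + t • z).1) ^ p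
  simp only [Prod.fst_add, Prod.snd_add, Prod.smul_fst, Prod.smul_snd, smul_eq_mul]
  have hfst : (1 - ε) * x.1 ≤ s * x.1 + t * z.1 := by
    obtain rfl : s = 1 - t := by linarith
    nlinarith [mul_le_mul_of_nonneg_left hzx ht, mul_nonneg hs (mul_nonneg hε0 hx1p.le)]
  have hsnd : (s * x.2 + t * z.2) * (1 - δ) ≤ (Q * x.1) ^ p := by
    have hx2p : 0 ≤ x.2 := by rw [hx2]; positivity
    obtain rfl : s = 1 - t := by linarith
    nlinarith [mul_le_mul_of_nonneg_left hz2' ht, mul_le_mul_of_nonneg_left hxQ' hs,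
      mul_nonneg hs (mul_nonneg hδ.le hx2p)]
  have hbase : (Q₁ * ((1 - ε) * x.1)) ^ p ≤ (Q₁ * (s * x.1 + t * z.1)) ^ p :=
    Real.rpow_le_rpow (by have : 0 < Q₁ := by linarith
                          positivity)
      (mul_le_mul_of_nonneg_left hfst (by linarith)) hp0.le
  refine le_trans ?_ hbase
  rw [← mul_le_mul_iff_left₀ h1δ]
  refine hsnd.trans ?_
  have hQ0 : 0 < Q := by linarith
  rw [Real.mul_rpow hQ0.le hx1p.le, ← mul_assoc Q₁,
    Real.mul_rpow (mul_nonneg (by linarith) h2.le) hx1p.le]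
  nlinarith [mul_le_mul_of_nonneg_right h1.le (Real.rpow_pos_of_pos hx1p p).le]

/-- A line through a point below a convex curve cannot rise above the curve on both sides of
that point. -/
lemma segment_subset_belowCurve_or {p Q l : ℝ} (hp : 1 ≤ p) (hQ : 0 ≤ Q) (hl : l ∈ Ioo (0 : ℝ) 1)
    {x y z : ℝ × ℝ} (hy : 0 ≤ y.1) (hz : 0 ≤ z.1) (hx : x = l • y + (1 - l) • z)
    (hxQ : x ∈ belowCurve p Q) :
    segment ℝ x z ⊆ belowCurve p Q ∨ segment ℝ x y ⊆ belowCurve p Q := by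
  have hconv : ConvexOn ℝ (Ici (0 : ℝ)) fun a => (Q * a) ^ p := by
    have := ((convexOn_rpow hp).smul (Real.rpow_nonneg hQ p))
    refine this.congr fun a ha => ?_
    simp only [smul_eq_mul]
    rw [Real.mul_rpow hQ ha]
  have hl0 := hl.1
  have hl1 : 0 < 1 - l := sub_pos.2 hl.2
  have hx0 : 0 ≤ x.1 := by
    rw [hx]; simp only [Prod.fst_add, Prod.smul_fst, smul_eq_mul]; positivity
  by_contra! hcon
  obtain ⟨u, ⟨s, t, hs, ht, hst, rfl⟩, hu⟩ := Set.not_subset.1 hcon.1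
  obtain ⟨v, ⟨s', t', hs', ht', hst', rfl⟩, hv⟩ := Set.not_subset.1 hcon.2
  have htp : 0 < t := by
    refine lt_of_le_of_ne ht fun h => hu ?_
    obtain rfl : s = 1 := by linarith
    simpa [← h] using hxQ
  have htp' : 0 < t' := by
    refine lt_of_le_of_ne ht' fun h => hv ?_
    obtain rfl : s' = 1 := by linarith
    simpa [← h] using hxQ
  have hmem := hconv.convex_strict_epigraph
  have hu' : s • x + t • z ∈ {q : ℝ × ℝ | q.1 ∈ Ici (0 : ℝ) ∧ (Q * q.1) ^ p < q.2} := by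
    refine ⟨?_, not_le.1 hu⟩
    simp only [Prod.fst_add, Prod.smul_fst, smul_eq_mul, mem_Ici]; positivity
  have hv' : s' • x + t' • y ∈ {q : ℝ × ℝ | q.1 ∈ Ici (0 : ℝ) ∧ (Q * q.1) ^ p < q.2} := by
    refine ⟨?_, not_le.1 hv⟩
    simp only [Prod.fst_add, Prod.smul_fst, smul_eq_mul, mem_Ici]; positivity
  have hD : 0 < (1 - l) * t' + l * t := by positivity
  have := hmem hu' hv' (a := (1 - l) * t' / ((1 - l) * t' + l * t))
    (b := l * t / ((1 - l) * t' + l * t)) (by positivity) (by positivity)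
    (by field_simp)
  have heq : ((1 - l) * t' / ((1 - l) * t' + l * t)) • (s • x + t • z) +
      (l * t / ((1 - l) * t' + l * t)) • (s' • x + t' • y) = x := by
    obtain rfl : s = 1 - t := by linarith
    obtain rfl : s' = 1 - t' := by linarith
    rw [hx]
    ext <;> simp only [Prod.fst_add, Prod.smul_fst, Prod.snd_add, Prod.smul_snd, smul_eq_mul] <;>
      field_simp <;> ring
  rw [heq] at this
  exact absurd hxQ (not_le.2 this.2)

variable {n : ℕ} {μ : Measure (Fin n → ℝ)} {E : Type*} [NormedAddCommGroup E] [NormedSpace ℝ E]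

lemma IsBox.measurableSet {R : Set (Fin n → ℝ)} (hR : IsBox R) : MeasurableSet R := by
  obtain ⟨a, b, -, rfl⟩ := hR
  exact MeasurableSet.univ_pi fun i => measurableSet_Ioo

lemma measurableSet_coord_lt (i : Fin n) (c : ℝ) : MeasurableSet {x : Fin n → ℝ | x i < c} :=
  measurableSet_lt (measurable_pi_apply i) measurable_const

lemma measurableSet_lt_coord (i : Fin n) (c : ℝ) : MeasurableSet {x : Fin n → ℝ | c < x i} :=
  measurableSet_lt measurable_const (measurable_pi_apply i)

lemma NullHyperplanes.ae_ne (hμ : NullHyperplanes μ) (i : Fin n) (c : ℝ) :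
    ∀ᵐ x ∂μ, x i ≠ c := by
  rw [ae_iff]
  simpa using hμ i c

/-- The cut of `R` by a coordinate hyperplane exhausts `R` up to a null set. -/
lemma NullHyperplanes.ae_eq_union (hμ : NullHyperplanes μ) (R : Set (Fin n → ℝ)) (i : Fin n)
    (c : ℝ) : R =ᵐ[μ] (R ∩ {x | x i < c} ∪ R ∩ {x | c < x i} : Set (Fin n → ℝ)) := by
  filter_upwards [hμ.ae_ne i c] with x hx
  apply propext
  change x ∈ R ↔ (x ∈ R ∧ x i < c) ∨ (x ∈ R ∧ c < x i)
  rw [← and_or_left, lt_or_lt_iff_ne]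
  simp [hx]

lemma disjoint_cuts (R : Set (Fin n → ℝ)) (i : Fin n) (c : ℝ) :
    Disjoint (R ∩ {x | x i < c}) (R ∩ {x | c < x i}) := by
  rw [Set.disjoint_left]
  rintro x ⟨-, h⟩ ⟨-, h'⟩
  exact lt_asymm (show x i < c from h) h'

lemma NullHyperplanes.setLIntegral_eq_add (hμ : NullHyperplanes μ) {R : Set (Fin n → ℝ)}
    (hR : MeasurableSet R) (i : Fin n) (c : ℝ) (f : (Fin n → ℝ) → ENNReal) :
    ∫⁻ x in R, f x ∂μ =
      ∫⁻ x in R ∩ {x | x i < c}, f x ∂μ + ∫⁻ x in R ∩ {x | c < x i}, f x ∂μ := by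
  rw [setLIntegral_congr (hμ.ae_eq_union R i c),
    lintegral_union (hR.inter (measurableSet_lt_coord i c)) (disjoint_cuts R i c)]

lemma NullHyperplanes.measure_eq_add (hμ : NullHyperplanes μ) {R : Set (Fin n → ℝ)}
    (hR : MeasurableSet R) (i : Fin n) (c : ℝ) :
    μ R = μ (R ∩ {x | x i < c}) + μ (R ∩ {x | c < x i}) := by
  simpa using hμ.setLIntegral_eq_add hR i c fun _ => 1

lemma NullHyperplanes.setIntegral_eq_add (hμ : NullHyperplanes μ) {R : Set (Fin n → ℝ)}
    (hR : MeasurableSet R) (i : Fin n) (c : ℝ) {f : (Fin n → ℝ) → E} (hf : IntegrableOn f R μ) :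
    ∫ x in R, f x ∂μ =
      ∫ x in R ∩ {x | x i < c}, f x ∂μ + ∫ x in R ∩ {x | c < x i}, f x ∂μ := by
  rw [setIntegral_congr_set (hμ.ae_eq_union R i c),
    setIntegral_union (disjoint_cuts R i c) (hR.inter (measurableSet_lt_coord i c))
      (hf.mono_set inter_subset_left) (hf.mono_set inter_subset_left)]

/-- Integrals over `R ∩ {x i < c}` depend continuously on the position `c` of the cut. -/
lemma NullHyperplanes.continuous_setIntegral (hμ : NullHyperplanes μ) {R : Set (Fin n → ℝ)}
    (i : Fin n) {f : (Fin n → ℝ) → E} (hf : IntegrableOn f R μ) :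
    Continuous fun c : ℝ => ∫ x in R ∩ {x | x i < c}, f x ∂μ := by
  have heq : (fun c : ℝ => ∫ x in R ∩ {x | x i < c}, f x ∂μ) =
      fun c => ∫ x in R, ({x | x i < c} : Set (Fin n → ℝ)).indicator f x ∂μ := by
    ext1 c
    rw [setIntegral_indicator (measurableSet_coord_lt i c)]
  rw [heq, continuous_iff_continuousAt]
  intro c
  refine continuousAt_of_dominated (bound := fun x => ‖f x‖)
    (Eventually.of_forall fun c' => hf.aestronglyMeasurable.indicator (measurableSet_coord_lt i c'))
    (Eventually.of_forall fun c' => Eventually.of_forall fun x => norm_indicator_le_norm_self _ _)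
    hf.norm ?_
  filter_upwards [ae_restrict_of_ae (hμ.ae_ne i c)] with x hx
  rcases lt_or_gt_of_ne hx with h | h
  · refine (continuousAt_const (y := f x)).congr ?_
    filter_upwards [lt_mem_nhds h] with c' hc'
    rw [indicator_of_mem (show x ∈ {x : Fin n → ℝ | x i < c'} from hc')]
  · refine (continuousAt_const (y := (0 : E))).congr ?_
    filter_upwards [gt_mem_nhds h] with c' hc'
    rw [indicator_of_notMem (show x ∉ {x : Fin n → ℝ | x i < c'} from not_lt.2 hc'.le)]

lemma isBox_inter_coord_lt {a b : Fin n → ℝ} (hab : ∀ i, a i < b i) {i : Fin n} {c : ℝ}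
    (hc : a i < c) (hcb : c ≤ b i) :
    IsBox ((univ.pi fun j => Ioo (a j) (b j)) ∩ {x | x i < c}) := by
  refine ⟨a, Function.update b i c, fun j => ?_, ?_⟩
  · rcases eq_or_ne j i with rfl | h
    · simpa using hc
    · simpa [h] using hab j
  · ext x
    simp only [mem_inter_iff, mem_univ_pi, mem_Ioo, mem_ofPred_eq]
    constructor
    · rintro ⟨h, hx⟩ j
      rcases eq_or_ne j i with rfl | hj
      · simpa using ⟨(h j).1, hx⟩
      · simpa [hj] using h j
    · intro h
      have hi := h i
      simp only [Function.update_self] at hi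
      refine ⟨fun j => ?_, hi.2⟩
      rcases eq_or_ne j i with rfl | hj
      · exact ⟨hi.1, hi.2.trans_le hcb⟩
      · simpa [hj] using h j

lemma isBox_inter_lt_coord {a b : Fin n → ℝ} (hab : ∀ i, a i < b i) {i : Fin n} {c : ℝ}
    (hc : a i ≤ c) (hcb : c < b i) :
    IsBox ((univ.pi fun j => Ioo (a j) (b j)) ∩ {x | c < x i}) := by
  refine ⟨Function.update a i c, b, fun j => ?_, ?_⟩
  · rcases eq_or_ne j i with rfl | h
    · simpa using hcb
    · simpa [h] using hab j
  · ext x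
    simp only [mem_inter_iff, mem_univ_pi, mem_Ioo, mem_ofPred_eq]
    constructor
    · rintro ⟨h, hx⟩ j
      rcases eq_or_ne j i with rfl | hj
      · simpa using ⟨hx, (h j).2⟩
      · simpa [hj] using h j
    · intro h
      have hi := h i
      simp only [Function.update_self] at hi
      refine ⟨fun j => ?_, hi.1⟩
      rcases eq_or_ne j i with rfl | hj
      · exact ⟨hc.trans_lt hi.1, hi.2⟩
      · simpa [hj] using h j

/-- A box that is charged by `μ` and has finite measure. -/
def IsChargedBox (μ : Measure (Fin n → ℝ)) (R : Set (Fin n → ℝ)) : Prop :=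
  IsBox R ∧ 0 < μ R ∧ μ R < ⊤

/-- The mean of a function over a finite-measure set is the mean of the means over its parts. -/
lemma NullHyperplanes.setAverage_eq_add (hμ : NullHyperplanes μ) {R : Set (Fin n → ℝ)}
    (hR : MeasurableSet R) (hRfin : μ R ≠ ⊤) (hR0 : μ R ≠ 0) (i : Fin n) (c : ℝ)
    {f : (Fin n → ℝ) → E} (hf : IntegrableOn f R μ) :
    ⨍ x in R, f x ∂μ =
      (μ.real (R ∩ {x | x i < c}) / μ.real R) • ⨍ x in R ∩ {x | x i < c}, f x ∂μ +
      (1 - μ.real (R ∩ {x | x i < c}) / μ.real R) • ⨍ x in R ∩ {x | c < x i}, f x ∂μ := by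
  have hfin : ∀ s : Set (Fin n → ℝ), μ (R ∩ s) ≠ ⊤ := fun s =>
    ne_top_of_le_ne_top hRfin (measure_mono inter_subset_left)
  have hM : μ.real R ≠ 0 := by simp [measureReal_def, ENNReal.toReal_eq_zero_iff, hR0, hRfin]
  have hadd : μ.real R = μ.real (R ∩ {x | x i < c}) + μ.real (R ∩ {x | c < x i}) := by
    rw [measureReal_def, hμ.measure_eq_add hR i c, ENNReal.toReal_add (hfin _) (hfin _)]
    rfl
  have hcoef : 1 - μ.real (R ∩ {x | x i < c}) / μ.real R =
      μ.real (R ∩ {x | c < x i}) / μ.real R := by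
    rw [one_sub_div hM]
    congr 1
    linarith
  rw [hcoef, div_eq_inv_mul, div_eq_inv_mul, mul_smul, mul_smul, measure_smul_setAverage _ (hfin _),
    measure_smul_setAverage _ (hfin _), ← smul_add, ← hμ.setIntegral_eq_add hR i c hf,
    setAverage_eq]

/-- Splitting lemma: if the averages over all charged boxes lie in the region `Ω_Q`, then every
charged box can be cut orthogonally to any coordinate axis into two charged boxes, each carrying
at least a fixed proportion of the mass, such that the segment between their averages lies in the
larger region `Ω_{Q₁}`. -/
lemma exists_cut {p Q Q₁ : ℝ} (hp : 1 < p) (hQ : 1 < Q) (hQ₁ : Q < Q₁)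
    (hμ : NullHyperplanes μ) {h : (Fin n → ℝ) → ℝ × ℝ}
    (hint : ∀ R, IsChargedBox μ R → IntegrableOn h R μ)
    (hmem : ∀ R, IsChargedBox μ R → ⨍ x in R, h x ∂μ ∈ powEpigraph p ∩ belowCurve p Q) :
    ∃ θ : ENNReal, θ < 1 ∧ ∀ R, IsChargedBox μ R → ∀ i : Fin n, ∃ c : ℝ,
      IsChargedBox μ (R ∩ {x | x i < c}) ∧ IsChargedBox μ (R ∩ {x | c < x i}) ∧
      μ (R ∩ {x | x i < c}) ≤ θ * μ R ∧ μ (R ∩ {x | c < x i}) ≤ θ * μ R ∧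
      segment ℝ (⨍ x in R ∩ {x | x i < c}, h x ∂μ) (⨍ x in R ∩ {x | c < x i}, h x ∂μ) ⊆
        powEpigraph p ∩ belowCurve p Q₁ := by
  obtain ⟨δ, hδ0, hδ1, hδ⟩ := exists_segment_subset_belowCurve hp hQ hQ₁
  refine ⟨ENNReal.ofReal (1 - δ), by simpa using hδ0, ?_⟩
  intro R hR i
  have hRm := hR.1.measurableSet
  obtain ⟨a, b, hab, hRab⟩ := hR.1
  have hRfin : μ R ≠ ⊤ := hR.2.2.ne
  have hR0 : μ R ≠ 0 := hR.2.1.ne'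
  have hfin : ∀ s : Set (Fin n → ℝ), μ (R ∩ s) ≠ ⊤ := fun s =>
    ne_top_of_le_ne_top hRfin (measure_mono inter_subset_left)
  have hM : 0 < μ.real R := ENNReal.toReal_pos hR0 hRfin
  set m : ℝ → ℝ := fun c => μ.real (R ∩ {x | x i < c}) with hm
  set m' : ℝ → ℝ := fun c => μ.real (R ∩ {x | c < x i}) with hm'
  have hmm' : ∀ c, m c + m' c = μ.real R := fun c => by
    rw [measureReal_def, hμ.measure_eq_add hRm i c, ENNReal.toReal_add (hfin _) (hfin _)]
    rfl
  have hmcont : Continuous m := by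
    have := hμ.continuous_setIntegral (R := R) i (f := fun _ => (1 : ℝ))
      (integrableOn_const hRfin)
    simpa using this
  have hmmono : Monotone m := fun c c' hcc' =>
    ENNReal.toReal_mono (hfin _) (measure_mono (inter_subset_inter_right _
      fun x hx => lt_of_lt_of_le hx hcc'))
  have hma : m (a i) = 0 := by
    have : R ∩ {x | x i < a i} = ∅ := by
      rw [eq_empty_iff_forall_notMem, hRab]
      rintro x ⟨hx, hx'⟩
      exact lt_asymm hx' (hx i (mem_univ i)).1
    simp [hm, this]
  have hmb : m (b i) = μ.real R := by
    have : R ∩ {x | x i < b i} = R := by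
      rw [inter_eq_left, hRab]
      exact fun x hx => (hx i (mem_univ i)).2
    simp [hm, this]
  obtain ⟨c₀, hc₀, hmc₀⟩ : δ * μ.real R ∈ m '' Icc (a i) (b i) := by
    apply intermediate_value_Icc (hab i).le hmcont.continuousOn
    rw [hma, hmb]
    constructor <;> nlinarith
  obtain ⟨c₁, hc₁, hmc₁⟩ : (1 - δ) * μ.real R ∈ m '' Icc c₀ (b i) := by
    apply intermediate_value_Icc hc₀.2 hmcont.continuousOn
    rw [hmc₀, hmb]
    constructor <;> nlinarith
  have hbd : ∀ c ∈ Icc c₀ c₁, δ * μ.real R ≤ m c ∧ m c ≤ (1 - δ) * μ.real R := fun c hc =>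
    ⟨hmc₀ ▸ hmmono hc.1, hmc₁ ▸ hmmono hc.2⟩
  have hcharged : ∀ c ∈ Icc c₀ c₁,
      IsChargedBox μ (R ∩ {x | x i < c}) ∧ IsChargedBox μ (R ∩ {x | c < x i}) := by
    intro c hc
    obtain ⟨h1, h2⟩ := hbd c hc
    have h3 := hmm' c
    have hpos : 0 < m c := lt_of_lt_of_le (by positivity) h1
    have hpos' : 0 < m' c := by nlinarith
    have hac : a i < c := by
      by_contra! hcon
      exact absurd (hmmono hcon) (by rw [hma]; exact not_le.2 hpos)
    have hcb : c < b i := by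
      by_contra! hcon
      have := hmmono hcon
      rw [hmb] at this
      linarith
    refine ⟨⟨?_, (ENNReal.toReal_pos_iff.1 hpos)⟩, ⟨?_, (ENNReal.toReal_pos_iff.1 hpos')⟩⟩
    · rw [hRab]; exact isBox_inter_coord_lt hab hac hcb.le
    · rw [hRab]; exact isBox_inter_lt_coord hab hac.le hcb
  set X := ⨍ x in R, h x ∂μ with hX
  set Y : ℝ → ℝ × ℝ := fun c => ⨍ x in R ∩ {x | x i < c}, h x ∂μ with hY
  set Z : ℝ → ℝ × ℝ := fun c => ⨍ x in R ∩ {x | c < x i}, h x ∂μ with hZ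
  have hXQ := hmem R hR
  have hXYZ : ∀ c, X = (m c / μ.real R) • Y c + (1 - m c / μ.real R) • Z c := fun c =>
    hμ.setAverage_eq_add hRm hRfin hR0 i c (hint R hR)
  have hYcont : ContinuousOn Y (Icc c₀ c₁) := by
    have : Y = fun c => (m c)⁻¹ • ∫ x in R ∩ {x | x i < c}, h x ∂μ := by
      ext1 c; exact setAverage_eq ..
    rw [this]
    refine ContinuousOn.smul (hmcont.continuousOn.inv₀ fun c hc => ?_)
      (hμ.continuous_setIntegral i (hint R hR)).continuousOn
    exact (lt_of_lt_of_le (by positivity) (hbd c hc).1).ne'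
  have hZcont : ContinuousOn Z (Icc c₀ c₁) := by
    have : Z = fun c => (μ.real R - m c)⁻¹ •
        (∫ x in R, h x ∂μ - ∫ x in R ∩ {x | x i < c}, h x ∂μ) := by
      ext1 c
      rw [hμ.setIntegral_eq_add hRm i c (hint R hR), add_sub_cancel_left, ← hmm' c,
        add_sub_cancel_left]
      exact setAverage_eq ..
    rw [this]
    refine ContinuousOn.smul ((continuous_const.sub hmcont).continuousOn.inv₀ fun c hc => ?_)
      (continuous_const.sub (hμ.continuous_setIntegral i (hint R hR))).continuousOn
    have := (hbd c hc).2
    exact (show 0 < μ.real R - m c by nlinarith).ne'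
  have hclosed : ∀ W : ℝ → ℝ × ℝ, ContinuousOn W (Icc c₀ c₁) →
      IsClosed {c | c ∈ Icc c₀ c₁ ∧ segment ℝ X (W c) ⊆ belowCurve p Q₁} := by
    intro W hW
    have : {c | c ∈ Icc c₀ c₁ ∧ segment ℝ X (W c) ⊆ belowCurve p Q₁} =
        Icc c₀ c₁ ∩ ⋂ s ∈ Icc (0 : ℝ) 1,
          (Icc c₀ c₁ ∩ (fun c => (1 - s) • X + s • W c) ⁻¹' belowCurve p Q₁) := by
      ext c
      simp only [segment_eq_image, image_subset_iff, mem_inter_iff, mem_iInter₂, mem_ofPred_eq]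
      exact and_congr_right fun hc => ⟨fun H s hs => ⟨hc, H hs⟩, fun H s hs => (H s hs).2⟩
    rw [this]
    refine isClosed_Icc.inter (isClosed_biInter fun s _ => ?_)
    exact (continuousOn_const.add (hW.const_smul s)).preimage_isClosed_of_isClosed isClosed_Icc
      (isClosed_belowCurve (by linarith) Q₁)
  have hBelow : belowCurve p Q ∩ powEpigraph p ⊆ belowCurve p Q₁ := fun y hy =>
    le_trans hy.1 (Real.rpow_le_rpow (mul_nonneg (by linarith) hy.2.1.le)
      (mul_le_mul_of_nonneg_right hQ₁.le hy.2.1.le) (by linarith))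
  have hc₀mem : c₀ ∈ Icc c₀ c₁ := ⟨le_rfl, hc₁.1⟩
  have hc₁mem : c₁ ∈ Icc c₀ c₁ := ⟨hc₁.1, le_rfl⟩
  have hYZ : ∀ c ∈ Icc c₀ c₁, Y c ∈ powEpigraph p ∧ Z c ∈ powEpigraph p := fun c hc =>
    ⟨(hmem _ (hcharged c hc).1).1, (hmem _ (hcharged c hc).2).1⟩
  obtain ⟨c, hc, ⟨-, hcY⟩, -, hcZ⟩ := isPreconnected_closed_iff.1 isPreconnected_Icc _ _
    (hclosed Y hYcont) (hclosed Z hZcont) (by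
      intro c hc
      have hl : m c / μ.real R ∈ Ioo (0 : ℝ) 1 := by
        obtain ⟨h1, h2⟩ := hbd c hc
        refine ⟨div_pos (lt_of_lt_of_le (by positivity) h1) hM, ?_⟩
        rw [div_lt_one hM]
        nlinarith
      exact (segment_subset_belowCurve_or hp.le (by linarith) hl (hYZ c hc).1.1.le
        (hYZ c hc).2.1.le (hXYZ c) (hBelow ⟨hXQ.2, hXQ.1⟩)).symm.imp (⟨hc, ·⟩) (⟨hc, ·⟩))
    ⟨c₁, hc₁mem, hc₁mem, hδ X (Z c₁) (Y c₁) (hYZ _ hc₁mem).2 (hYZ _ hc₁mem).1 (by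
      rw [hXYZ c₁, hmc₁, mul_div_cancel_right₀ _ hM.ne', sub_sub_cancel, add_comm]) hXQ.2⟩
    ⟨c₀, hc₀mem, hc₀mem, hδ X (Y c₀) (Z c₀) (hYZ _ hc₀mem).1 (hYZ _ hc₀mem).2 (by
      rw [hXYZ c₀, hmc₀, mul_div_cancel_right₀ _ hM.ne']) hXQ.2⟩
  have hθ : ∀ s : Set (Fin n → ℝ), μ.real (R ∩ s) ≤ (1 - δ) * μ.real R →
      μ (R ∩ s) ≤ ENNReal.ofReal (1 - δ) * μ R := by
    intro s hs
    rw [← ENNReal.ofReal_toReal (hfin s), ← ENNReal.ofReal_toReal hRfin,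
      ← ENNReal.ofReal_mul (by linarith)]
    exact ENNReal.ofReal_le_ofReal hs
  refine ⟨c, (hcharged c hc).1, (hcharged c hc).2, hθ _ (hbd c hc).2, hθ _ ?_,
    subset_inter ((convex_powEpigraph hp.le).segment_subset (hYZ c hc).1 (hYZ c hc).2) ?_⟩
  · have h1 := (hbd c hc).1
    have h2 := hmm' c
    change m' c ≤ _
    linarith
  · have hXmem : X ∈ segment ℝ (Y c) (Z c) := by
      obtain ⟨h1, h2⟩ := hbd c hc
      have h3 : 0 ≤ m c / μ.real R := by positivity
      have h4 : m c / μ.real R ≤ 1 := by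
        rw [div_le_one hM]
        nlinarith
      exact ⟨_, _, h3, sub_nonneg.2 h4, by ring, (hXYZ c).symm⟩
    intro y hy
    rw [segment_eq_image_lineMap] at hXmem
    rw [← insert_endpoints_openSegment] at hy
    rcases hy with rfl | rfl | hy
    · exact hcY (right_mem_segment ..)
    · exact hcZ (right_mem_segment ..)
    · rcases openSegment_subset_union (Y c) (Z c) (image_subset_range _ _ hXmem) hy with
        rfl | hy | hy
      · exact hcY (left_mem_segment ..)
      · exact hcY (segment_symm ℝ (Y c) X ▸ openSegment_subset_segment _ _ _ hy)
      · exact hcZ (openSegment_subset_segment _ _ _ hy)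

/-- The piece containing `x` after cutting `R` successively along the coordinates listed, where
`c S i` is the position of the cut of `S` orthogonal to the `i`-th axis. -/
def iterCut (c : Set (Fin n → ℝ) → Fin n → ℝ) :
    List (Fin n) → Set (Fin n → ℝ) → (Fin n → ℝ) → Set (Fin n → ℝ)
  | [], R, _ => R
  | i :: L, R, x =>
    if x i < c R i then iterCut c L (R ∩ {y | y i < c R i}) x
    else iterCut c L (R ∩ {y | c R i < y i}) x

/-- The cuts `c` never leave the class of charged boxes. -/
def IsCutRule (μ : Measure (Fin n → ℝ)) (c : Set (Fin n → ℝ) → Fin n → ℝ) : Prop :=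
  ∀ R, IsChargedBox μ R → ∀ i : Fin n,
    IsChargedBox μ (R ∩ {x | x i < c R i}) ∧ IsChargedBox μ (R ∩ {x | c R i < x i})

variable {c : Set (Fin n → ℝ) → Fin n → ℝ}

lemma IsCutRule.isChargedBox_iterCut (hc : IsCutRule μ c) (L : List (Fin n)) :
    ∀ {R : Set (Fin n → ℝ)}, IsChargedBox μ R → ∀ x, IsChargedBox μ (iterCut c L R x) := by
  induction L with
  | nil => exact fun hR _ => hR
  | cons i L ih =>
    intro R hR x
    rw [iterCut]
    split_ifs
    · exact ih (hc R hR i).1 x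
    · exact ih (hc R hR i).2 x

lemma stronglyMeasurable_comp_iterCut {β : Type*} [TopologicalSpace β]
    (f : Set (Fin n → ℝ) → β) (L : List (Fin n)) :
    ∀ R : Set (Fin n → ℝ), StronglyMeasurable fun x => f (iterCut c L R x) := by
  induction L with
  | nil => exact fun R => stronglyMeasurable_const (b := f R)
  | cons i L ih =>
    intro R
    simp only [iterCut, apply_ite f]
    exact StronglyMeasurable.ite (measurableSet_coord_lt i _) (ih _) (ih _)

lemma iterCut_cons_of_mem_lt {i : Fin n} {L : List (Fin n)} {R : Set (Fin n → ℝ)} {x : Fin n → ℝ}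
    (hx : x ∈ R ∩ {y | y i < c R i}) :
    iterCut c (i :: L) R x = iterCut c L (R ∩ {y | y i < c R i}) x :=
  if_pos hx.2

lemma iterCut_cons_of_mem_gt {i : Fin n} {L : List (Fin n)} {R : Set (Fin n → ℝ)} {x : Fin n → ℝ}
    (hx : x ∈ R ∩ {y | c R i < y i}) :
    iterCut c (i :: L) R x = iterCut c L (R ∩ {y | c R i < y i}) x :=
  if_neg (not_lt.2 (le_of_lt hx.2))

lemma IsCutRule.ae_mem_iterCut (hc : IsCutRule μ c) (hμ : NullHyperplanes μ) (L : List (Fin n)) :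
    ∀ {R : Set (Fin n → ℝ)}, IsChargedBox μ R → ∀ᵐ x ∂μ.restrict R, x ∈ iterCut c L R x := by
  induction L with
  | nil => exact fun hR => ae_restrict_mem hR.1.measurableSet
  | cons i L ih =>
    intro R hR
    rw [Measure.restrict_congr_set (hμ.ae_eq_union R i (c R i)), ae_restrict_union_iff]
    obtain ⟨h1, h2⟩ := hc R hR i
    constructor
    · filter_upwards [ih h1, ae_restrict_mem h1.1.measurableSet] with x hx hxm
      rwa [iterCut_cons_of_mem_lt hxm]
    · filter_upwards [ih h2, ae_restrict_mem h2.1.measurableSet] with x hx hxm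
      rwa [iterCut_cons_of_mem_gt hxm]

/-- If each cut along the `i`-th axis multiplies the mass-weighted total of `ψ` by at most `κ i`,
then iterated cuts multiply it by at most the product of the factors. -/
lemma IsCutRule.lintegral_iterCut_le (hc : IsCutRule μ c) (hμ : NullHyperplanes μ)
    (κ : Fin n → ENNReal) (ψ : Set (Fin n → ℝ) → ENNReal)
    (hψ : ∀ R, IsChargedBox μ R → ∀ i : Fin n,
      ψ (R ∩ {x | x i < c R i}) * μ (R ∩ {x | x i < c R i}) +
        ψ (R ∩ {x | c R i < x i}) * μ (R ∩ {x | c R i < x i}) ≤ κ i * (ψ R * μ R))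
    (L : List (Fin n)) :
    ∀ {R : Set (Fin n → ℝ)}, IsChargedBox μ R →
      ∫⁻ x in R, ψ (iterCut c L R x) ∂μ ≤ (L.map κ).prod * (ψ R * μ R) := by
  induction L with
  | nil => intro R hR; simp [iterCut]
  | cons i L ih =>
    intro R hR
    obtain ⟨h1, h2⟩ := hc R hR i
    rw [hμ.setLIntegral_eq_add hR.1.measurableSet i (c R i),
      setLIntegral_congr_fun h1.1.measurableSet fun x hx => by
        rw [iterCut_cons_of_mem_lt hx],
      setLIntegral_congr_fun h2.1.measurableSet fun x hx => by
        rw [iterCut_cons_of_mem_gt hx]]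
    calc _ ≤ (L.map κ).prod * _ + (L.map κ).prod * _ := add_le_add (ih h1) (ih h2)
      _ ≤ (L.map κ).prod * (κ i * (ψ R * μ R)) := by
        rw [← mul_add]
        exact mul_le_mul_right (hψ R hR i) _
      _ = _ := by
        rw [List.map_cons, List.prod_cons]
        ring

/-- The list that runs `k` times through all coordinates. -/
def sweeps (n k : ℕ) : List (Fin n) := (List.replicate k (List.finRange n)).flatten

lemma prod_map_sweeps (κ : Fin n → ENNReal) (k : ℕ) :
    ((sweeps n k).map κ).prod = (∏ i, κ i) ^ k := by
  induction k with
  | zero => simp [sweeps]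
  | succ k ih =>
    have : sweeps n (k + 1) = List.finRange n ++ sweeps n k := by
      simp [sweeps, List.replicate_succ]
    rw [this, List.map_append, List.prod_append, ih, ← Fin.prod_univ_def, pow_succ']

/-- If every cut leaves at most the fraction `θ` of the mass on each side, then almost every point
eventually lies in a piece that does not straddle a given coordinate hyperplane. -/
lemma IsCutRule.ae_eventually_not_straddle (hc : IsCutRule μ c) (hμ : NullHyperplanes μ)
    {θ : ENNReal} (hθ : θ < 1)
    (hcθ : ∀ R, IsChargedBox μ R → ∀ i : Fin n,
      μ (R ∩ {x | x i < c R i}) ≤ θ * μ R ∧ μ (R ∩ {x | c R i < x i}) ≤ θ * μ R)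
    {R : Set (Fin n → ℝ)} (hR : IsChargedBox μ R) (i : Fin n) (q : ℝ) :
    ∀ᵐ x ∂μ.restrict R, ∀ᶠ k in atTop,
      iterCut c (sweeps n k) R x ⊆ {y | y i ≤ q} ∨ iterCut c (sweeps n k) R x ⊆ {y | q ≤ y i} := by
  classical
  set ψ : Set (Fin n → ℝ) → ENNReal :=
    fun S => if S ⊆ {y | y i ≤ q} ∨ S ⊆ {y | q ≤ y i} then 0 else 1 with hψ
  have hψmono : ∀ S T, ψ (S ∩ T) ≤ ψ S := by
    intro S T
    simp only [hψ]
    split_ifs with h1 h2 h2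
    · exact le_rfl
    · exact zero_le_one
    · exact absurd (h2.imp (inter_subset_left.trans ·) (inter_subset_left.trans ·)) h1
    · exact le_rfl
  have hstep : ∀ R, IsChargedBox μ R → ∀ j : Fin n,
      ψ (R ∩ {x | x j < c R j}) * μ (R ∩ {x | x j < c R j}) +
        ψ (R ∩ {x | c R j < x j}) * μ (R ∩ {x | c R j < x j}) ≤
      (if j = i then θ else 1) * (ψ R * μ R) := by
    intro R hR j
    split_ifs with hj
    · subst hj
      rcases le_total (c R j) q with hq | hq
      · have : ψ (R ∩ {x | x j < c R j}) = 0 :=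
          if_pos (Or.inl fun x hx => (le_of_lt hx.2).trans hq)
        rw [this, zero_mul, zero_add, mul_left_comm]
        exact mul_le_mul' (hψmono _ _) (hcθ R hR j).2
      · have : ψ (R ∩ {x | c R j < x j}) = 0 :=
          if_pos (Or.inr fun x hx => hq.trans (le_of_lt hx.2))
        rw [this, zero_mul, add_zero, mul_left_comm]
        exact mul_le_mul' (hψmono _ _) (hcθ R hR j).1
    · rw [one_mul, hμ.measure_eq_add hR.1.measurableSet j (c R j), mul_add]
      exact add_le_add (mul_le_mul' (hψmono _ _) le_rfl) (mul_le_mul' (hψmono _ _) le_rfl)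
  have hbound : ∀ k, ∫⁻ x in R, ψ (iterCut c (sweeps n k) R x) ∂μ ≤ θ ^ k * (ψ R * μ R) := by
    intro k
    have := hc.lintegral_iterCut_le hμ _ ψ hstep (sweeps n k) hR
    rwa [prod_map_sweeps, Finset.prod_ite_eq' Finset.univ i (fun _ => θ),
      if_pos (Finset.mem_univ i)] at this
  have hψR : ψ R * μ R ≠ ⊤ := by
    refine ENNReal.mul_ne_top ?_ hR.2.2.ne
    simp only [hψ]
    split_ifs <;> simp
  have hsum : ∫⁻ x in R, ∑' k, ψ (iterCut c (sweeps n k) R x) ∂μ ≠ ⊤ := by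
    rw [lintegral_tsum fun k =>
      (stronglyMeasurable_comp_iterCut ψ (sweeps n k) R).measurable.aemeasurable]
    refine ne_top_of_le_ne_top ?_ (ENNReal.tsum_le_tsum hbound)
    rw [ENNReal.tsum_mul_right, ENNReal.tsum_geometric]
    exact ENNReal.mul_ne_top (ENNReal.inv_ne_top.2 (tsub_pos_of_lt hθ).ne') hψR
  filter_upwards [ae_lt_top (Measurable.tsum fun k =>
    (stronglyMeasurable_comp_iterCut ψ (sweeps n k) R).measurable) hsum] with x hx
  filter_upwards [(ENNReal.tendsto_atTop_zero_of_tsum_ne_top hx.ne).eventually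
    (gt_mem_nhds one_pos)] with k hk
  by_contra hcon
  rw [hψ] at hk
  simp [hcon] at hk

lemma IsCutRule.ae_eventually_iterCut_subset (hc : IsCutRule μ c) (hμ : NullHyperplanes μ)
    {θ : ENNReal} (hθ : θ < 1)
    (hcθ : ∀ R, IsChargedBox μ R → ∀ i : Fin n,
      μ (R ∩ {x | x i < c R i}) ≤ θ * μ R ∧ μ (R ∩ {x | c R i < x i}) ≤ θ * μ R)
    {R : Set (Fin n → ℝ)} (hR : IsChargedBox μ R) :
    ∀ᵐ x ∂μ.restrict R, ∀ ε > 0, ∀ᶠ k in atTop,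
      iterCut c (sweeps n k) R x ⊆ Metric.closedBall x ε := by
  have h1 : ∀ᵐ x ∂μ.restrict R, ∀ k, x ∈ iterCut c (sweeps n k) R x :=
    ae_all_iff.2 fun k => hc.ae_mem_iterCut hμ _ hR
  have h2 : ∀ᵐ x ∂μ.restrict R, ∀ (i : Fin n) (q : ℚ), ∀ᶠ k in atTop,
      iterCut c (sweeps n k) R x ⊆ {y | y i ≤ q} ∨ iterCut c (sweeps n k) R x ⊆ {y | q ≤ y i} :=
    ae_all_iff.2 fun i => ae_all_iff.2 fun q => hc.ae_eventually_not_straddle hμ hθ hcθ hR i q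
  filter_upwards [h1, h2] with x hx1 hx2 ε hε
  have h3 : ∀ i : Fin n, ∀ᶠ k in atTop,
      iterCut c (sweeps n k) R x ⊆ {y | |y i - x i| ≤ ε} := by
    intro i
    obtain ⟨q, hq, hq'⟩ := exists_rat_btwn (show x i - ε < x i by linarith)
    obtain ⟨q', hqq, hqq'⟩ := exists_rat_btwn (show x i < x i + ε by linarith)
    filter_upwards [hx2 i q, hx2 i q'] with k hk hk' y hy
    have hlow : (q : ℝ) ≤ y i :=
      hk.elim (fun H => absurd (H (hx1 k)) (not_le.2 hq')) fun H => H hy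
    have hupp : y i ≤ q' :=
      hk'.elim (fun H => H hy) fun H => absurd (H (hx1 k)) (not_le.2 hqq)
    rw [mem_ofPred_eq, abs_le]
    constructor <;> linarith
  filter_upwards [eventually_all.2 h3] with k hk y hy
  rw [Metric.mem_closedBall, dist_pi_le_iff hε.le]
  exact fun i => hk i hy

/-- Averages over iterated pieces contract the `L¹` norm. -/
lemma IsCutRule.lintegral_enorm_average_le (hc : IsCutRule μ c) (hμ : NullHyperplanes μ)
    (f : (Fin n → ℝ) → E) (L : List (Fin n)) {R : Set (Fin n → ℝ)} (hR : IsChargedBox μ R) :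
    ∫⁻ x in R, ‖⨍ y in iterCut c L R x, f y ∂μ‖ₑ ∂μ ≤ ∫⁻ x in R, ‖f x‖ₑ ∂μ := by
  set ψ : Set (Fin n → ℝ) → ENNReal := fun S => (μ S)⁻¹ * ∫⁻ x in S, ‖f x‖ₑ ∂μ with hψ
  have hψS : ∀ S, IsChargedBox μ S → ψ S * μ S = ∫⁻ x in S, ‖f x‖ₑ ∂μ := fun S hS => by
    rw [hψ, mul_comm, ← mul_assoc, ENNReal.mul_inv_cancel hS.2.1.ne' hS.2.2.ne, one_mul]
  have hle : ∀ S, IsChargedBox μ S → ‖⨍ y in S, f y ∂μ‖ₑ ≤ ψ S := fun S hS => by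
    rw [setAverage_eq, enorm_smul, Real.enorm_eq_ofReal (by positivity),
      measureReal_def,
      ENNReal.ofReal_inv_of_pos (ENNReal.toReal_pos hS.2.1.ne' hS.2.2.ne),
      ENNReal.ofReal_toReal hS.2.2.ne]
    exact mul_le_mul_right (enorm_integral_le_lintegral_enorm _) _
  calc _ ≤ ∫⁻ x in R, ψ (iterCut c L R x) ∂μ :=
        lintegral_mono fun x => hle _ (hc.isChargedBox_iterCut L hR x)
    _ ≤ (L.map fun _ => 1).prod * (ψ R * μ R) := by
        refine hc.lintegral_iterCut_le hμ (fun _ => 1) ψ (fun S hS i => ?_) L hR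
        obtain ⟨h1, h2⟩ := hc S hS i
        rw [hψS _ h1, hψS _ h2, hψS _ hS, one_mul,
          ← hμ.setLIntegral_eq_add hS.1.measurableSet]
    _ = _ := by
        rw [hψS R hR]
        simp

lemma IsCutRule.tendsto_lintegral_average_of_continuous [CompleteSpace E] (hc : IsCutRule μ c)
    (hμ : NullHyperplanes μ) {θ : ENNReal} (hθ : θ < 1)
    (hcθ : ∀ R, IsChargedBox μ R → ∀ i : Fin n,
      μ (R ∩ {x | x i < c R i}) ≤ θ * μ R ∧ μ (R ∩ {x | c R i < x i}) ≤ θ * μ R)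
    {R : Set (Fin n → ℝ)} (hR : IsChargedBox μ R) (g : BoundedContinuousFunction (Fin n → ℝ) E) :
    Tendsto (fun k => ∫⁻ x in R, ‖(⨍ y in iterCut c (sweeps n k) R x, g y ∂μ) - g x‖ₑ ∂μ)
      atTop (nhds 0) := by
  have hint : ∀ S, IsChargedBox μ S → IntegrableOn g S μ := fun S hS => by
    have : IsFiniteMeasure (μ.restrict S) := ⟨by simpa using hS.2.2⟩
    exact Integrable.of_bound g.continuous.aestronglyMeasurable ‖g‖
      (Eventually.of_forall g.norm_coe_le_norm)
  have hclose : ∀ S, IsChargedBox μ S → ∀ (z : E) (ε : ℝ), (∀ y ∈ S, g y ∈ Metric.closedBall z ε) →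
      ⨍ y in S, g y ∂μ ∈ Metric.closedBall z ε := fun S hS z ε H =>
    (convex_closedBall z ε).set_average_mem Metric.isClosed_closedBall hS.2.1.ne' hS.2.2.ne
      (ae_restrict_of_forall_mem hS.1.measurableSet H) (hint S hS)
  have : ∫⁻ _ in R, (0 : ENNReal) ∂μ = 0 := lintegral_zero
  rw [← this]
  refine tendsto_lintegral_of_dominated_convergence' (fun _ => 2 * ‖g‖ₑ) (fun k => ?_) (fun k => ?_)
    ?_ ?_
  · exact ((stronglyMeasurable_comp_iterCut (fun S => ⨍ y in S, g y ∂μ) _ R).aestronglyMeasurable.sub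
      g.continuous.aestronglyMeasurable).enorm
  · refine Eventually.of_forall fun x => ?_
    have h0 : ‖⨍ y in iterCut c (sweeps n k) R x, g y ∂μ‖ ≤ ‖g‖ := by
      simpa using hclose _ (hc.isChargedBox_iterCut (sweeps n k) hR x) 0 ‖g‖
        fun y _ => by simpa using g.norm_coe_le_norm y
    rw [two_mul]
    refine enorm_sub_le.trans (add_le_add ?_ ?_)
    · exact enorm_le_iff_norm_le.2 h0
    · exact enorm_le_iff_norm_le.2 (g.norm_coe_le_norm x)
  · rw [lintegral_const]
    exact ENNReal.mul_ne_top (ENNReal.mul_ne_top (by simp) enorm_ne_top) (by simpa using hR.2.2.ne)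
  · filter_upwards [hc.ae_eventually_iterCut_subset hμ hθ hcθ hR] with x hx
    rw [← tendsto_zero_iff_enorm_tendsto_zero (f := fun k =>
      (⨍ y in iterCut c (sweeps n k) R x, g y ∂μ) - g x), ← tendsto_sub_nhds_zero_iff.symm,
      Metric.nhds_basis_closedBall.tendsto_right_iff]
    intro ε hε
    obtain ⟨η, hη, hg⟩ := Metric.nhds_basis_closedBall.mem_iff.1
      (g.continuous.continuousAt (Metric.closedBall_mem_nhds (g x) hε))
    filter_upwards [hx η hη] with k hk
    exact hclose _ (hc.isChargedBox_iterCut (sweeps n k) hR x) _ _ fun y hy => hg (hk hy)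

/-- The averages of an integrable function over iterated pieces converge to it in `L¹`. -/
lemma IsCutRule.tendsto_lintegral_average [CompleteSpace E] (hc : IsCutRule μ c)
    (hμ : NullHyperplanes μ) {θ : ENNReal} (hθ : θ < 1)
    (hcθ : ∀ R, IsChargedBox μ R → ∀ i : Fin n,
      μ (R ∩ {x | x i < c R i}) ≤ θ * μ R ∧ μ (R ∩ {x | c R i < x i}) ≤ θ * μ R)
    {f : (Fin n → ℝ) → E} (hf : ∀ R, IsChargedBox μ R → IntegrableOn f R μ)
    {R : Set (Fin n → ℝ)} (hR : IsChargedBox μ R) :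
    Tendsto (fun k => ∫⁻ x in R, ‖(⨍ y in iterCut c (sweeps n k) R x, f y ∂μ) - f x‖ₑ ∂μ)
      atTop (nhds 0) := by
  have : IsFiniteMeasure (μ.restrict R) := ⟨by simpa using hR.2.2⟩
  rw [ENNReal.tendsto_nhds_zero]
  intro ε hε
  have hε3 : ε / 3 ≠ 0 := (ENNReal.div_pos hε.ne' (by simp)).ne'
  obtain ⟨g, hg, hgint⟩ := (hf R hR).exists_boundedContinuous_lintegral_sub_le hε3
  have hgi : ∀ S, IsChargedBox μ S → IntegrableOn g S μ := fun S hS => by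
    have : IsFiniteMeasure (μ.restrict S) := ⟨by simpa using hS.2.2⟩
    exact Integrable.of_bound g.continuous.aestronglyMeasurable ‖g‖
      (Eventually.of_forall g.norm_coe_le_norm)
  filter_upwards [(ENNReal.tendsto_nhds_zero.1
    (hc.tendsto_lintegral_average_of_continuous hμ hθ hcθ hR g)) _ (pos_iff_ne_zero.2 hε3)]
    with k hk
  have hsplit : ∀ x, (⨍ y in iterCut c (sweeps n k) R x, f y ∂μ) - f x =
      (⨍ y in iterCut c (sweeps n k) R x, (f y - g y) ∂μ) +
        (((⨍ y in iterCut c (sweeps n k) R x, g y ∂μ) - g x) - (f x - g x)) := by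
    intro x
    have hS := hc.isChargedBox_iterCut (sweeps n k) hR x
    have : ⨍ y in iterCut c (sweeps n k) R x, (f y - g y) ∂μ =
        (⨍ y in iterCut c (sweeps n k) R x, f y ∂μ) -
          ⨍ y in iterCut c (sweeps n k) R x, g y ∂μ := by
      simp only [setAverage_eq]
      rw [integral_sub (hf _ hS) (hgi _ hS), smul_sub]
    rw [this]
    abel
  have hmeas1 := ((stronglyMeasurable_comp_iterCut (c := c) (fun S => ⨍ y in S, (f y - g y) ∂μ)
    (sweeps n k) R).aestronglyMeasurable (μ := μ.restrict R)).enorm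
  have hmeas2 : AEMeasurable (fun x => ‖(⨍ y in iterCut c (sweeps n k) R x, g y ∂μ) - g x‖ₑ)
      (μ.restrict R) := (((stronglyMeasurable_comp_iterCut (c := c) (fun S => ⨍ y in S, g y ∂μ)
    (sweeps n k) R).aestronglyMeasurable (μ := μ.restrict R)).sub
      g.continuous.aestronglyMeasurable).enorm
  calc _ ≤ ∫⁻ x in R, (‖⨍ y in iterCut c (sweeps n k) R x, (f y - g y) ∂μ‖ₑ +
        (‖(⨍ y in iterCut c (sweeps n k) R x, g y ∂μ) - g x‖ₑ + ‖f x - g x‖ₑ)) ∂μ := by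
        refine lintegral_mono fun x => ?_
        rw [hsplit x]
        exact (enorm_add_le _ _).trans (add_le_add_right enorm_sub_le _)
    _ ≤ ε / 3 + (ε / 3 + ε / 3) := by
        rw [lintegral_add_left' hmeas1, lintegral_add_left' hmeas2]
        exact add_le_add ((hc.lintegral_enorm_average_le hμ _ _ hR).trans hg) (add_le_add hk hg)
    _ = ε := by rw [← add_assoc, ENNReal.add_thirds]

/-- The averages of `(w, w^p)` over charged boxes lie in the region `Ω_Q`. -/
lemma average_mem_region {p Q : ℝ} (hp : 1 < p) (hQ : 0 ≤ Q) {w : (Fin n → ℝ) → ℝ}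
    (hw : ∀ᵐ x ∂μ, 0 < w x) (hRH : RHBound μ w p Q) {R : Set (Fin n → ℝ)}
    (hR : IsChargedBox μ R) :
    (⨍ x in R, w x ∂μ, ⨍ x in R, w x ^ p ∂μ) ∈ powEpigraph p ∩ belowCurve p Q := by
  obtain ⟨hwi, hwpi, hRHR⟩ := hRH R hR.1 hR.2.1 hR.2.2
  have hp0 : 0 < p := by linarith
  have hwR : ∀ᵐ x ∂μ.restrict R, 0 < w x := ae_restrict_of_ae hw
  have hpos : 0 < ⨍ x in R, w x ∂μ := by
    rw [setAverage_eq]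
    refine smul_pos (inv_pos.2 (ENNReal.toReal_pos hR.2.1.ne' hR.2.2.ne)) ?_
    rw [setIntegral_pos_iff_support_of_nonneg_ae (hwR.mono fun x hx => hx.le) hwi]
    have : (Function.support w ∩ R : Set (Fin n → ℝ)) =ᵐ[μ] R := by
      filter_upwards [hw] with x hx
      apply propext
      change x ∈ Function.support w ∧ x ∈ R ↔ x ∈ R
      simp [hx.ne']
    rw [measure_congr this]
    exact hR.2.1
  refine ⟨⟨hpos, ?_⟩, ?_⟩
  · exact (convexOn_rpow hp.le).map_set_average_le
      (continuousOn_id.rpow_const fun _ _ => Or.inr hp0.le) isClosed_Ici hR.2.1.ne' hR.2.2.ne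
      (hwR.mono fun x hx => hx.le) hwi hwpi
  · have hnn : 0 ≤ ⨍ x in R, w x ^ p ∂μ := by
      rw [setAverage_eq]
      exact smul_nonneg (by positivity)
        (integral_nonneg_of_ae (hwR.mono fun x hx => Real.rpow_nonneg hx.le p))
    rw [one_div] at hRHR
    exact (Real.rpow_inv_le_iff_of_pos hnn (mul_nonneg hQ hpos.le) hp0).1 hRHR

/-- A Bellman function (continuous, nonnegative, concave along segments
of `Ω_{Q₁} = {1 ≤ x₂^{1/p}x₁⁻¹ ≤ Q₁}`, majorizing `x₁^r` on the lower boundary) majorizes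
the `r`-average: for every weight with `[w]_{RH_p} ≤ Q < Q₁` and every box `R`,
`⟨w^r⟩_R ≤ B(⟨w⟩_R, ⟨w^p⟩_R)`. -/
theorem bellman_majorizes_average_RHp
    (p r Q Q₁ : ℝ) (hp : 1 < p) (hQ : 1 < Q) (hQ₁ : Q < Q₁)
    (Ω : Set (ℝ × ℝ))
    (hΩ : Ω = {x : ℝ × ℝ | 0 < x.1 ∧ 0 < x.2 ∧
      1 ≤ x.2 ^ (1 / p) * x.1⁻¹ ∧ x.2 ^ (1 / p) * x.1⁻¹ ≤ Q₁})
    (B : ℝ × ℝ → ℝ)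
    (hB0 : ∀ x ∈ Ω, 0 ≤ B x)
    (hBcont : ContinuousOn B Ω)
    (hBconc : ∀ x y : ℝ × ℝ, segment ℝ x y ⊆ Ω → ∀ l ∈ Icc (0:ℝ) 1,
      l * B x + (1 - l) * B y ≤ B (l • x + (1 - l) • y))
    (hBbdry : ∀ x1 : ℝ, 0 < x1 → x1 ^ r ≤ B (x1, x1 ^ p)) :
    ∀ n : ℕ, 1 ≤ n →
      ∀ μ : Measure (Fin n → ℝ), IsLocallyFiniteMeasure μ → NullHyperplanes μ →
        ∀ w : (Fin n → ℝ) → ℝ, Measurable w → (∀ᵐ x ∂μ, 0 < w x) →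
          RHBound μ w p Q →
          LocallyIntegrable (fun x => w x ^ r) μ →
          ∀ R : Set (Fin n → ℝ), IsBox R → 0 < μ R → μ R < ⊤ →
            boxAvg μ R (fun x => w x ^ r) ≤
              B (boxAvg μ R w, boxAvg μ R fun x => w x ^ p) := by
  intro n _ μ _ hμ w hwm hw hRH _ R₀ hR₀ hR₀pos hR₀fin
  have hR : IsChargedBox μ R₀ := ⟨hR₀, hR₀pos, hR₀fin⟩
  have hp0 : 0 < p := by linarith
  obtain rfl : Ω = powEpigraph p ∩ belowCurve p Q₁ := by
    rw [hΩ]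
    ext x
    exact mem_region_iff hp0 (by linarith) x
  set h : (Fin n → ℝ) → ℝ × ℝ := fun x => (w x, w x ^ p) with hh
  have hint : ∀ R, IsChargedBox μ R → IntegrableOn h R μ := fun R hR =>
    (hRH R hR.1 hR.2.1 hR.2.2).1.prodMk (hRH R hR.1 hR.2.1 hR.2.2).2.1
  have havg : ∀ R, IsChargedBox μ R →
      ⨍ x in R, h x ∂μ = (⨍ x in R, w x ∂μ, ⨍ x in R, w x ^ p ∂μ) := fun R hR =>
    average_pair (hRH R hR.1 hR.2.1 hR.2.2).1 (hRH R hR.1 hR.2.1 hR.2.2).2.1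
  have hmem : ∀ R, IsChargedBox μ R → ⨍ x in R, h x ∂μ ∈ powEpigraph p ∩ belowCurve p Q :=
    fun R hR => havg R hR ▸ average_mem_region hp (by linarith) hw hRH hR
  have hregion : powEpigraph p ∩ belowCurve p Q ⊆ powEpigraph p ∩ belowCurve p Q₁ :=
    fun y hy => ⟨hy.1, le_trans hy.2 (Real.rpow_le_rpow (mul_nonneg (by linarith) hy.1.1.le)
      (mul_le_mul_of_nonneg_right hQ₁.le hy.1.1.le) hp0.le)⟩
  obtain ⟨θ, hθ, hcut⟩ := exists_cut hp hQ hQ₁ hμ hint hmem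
  choose! c hc₁ hc₂ hcθ₁ hcθ₂ hseg using hcut
  have hc : IsCutRule μ c := fun R hR i => ⟨hc₁ R hR i, hc₂ R hR i⟩
  have hlim := hc.tendsto_lintegral_average hμ hθ (fun R hR i => ⟨hcθ₁ R hR i, hcθ₂ R hR i⟩)
    hint hR
  obtain ⟨ns, -, hns⟩ : ∃ ns : ℕ → ℕ, StrictMono ns ∧ ∀ᵐ x ∂μ.restrict R₀, Tendsto
      (fun k => ⨍ y in iterCut c (sweeps n (ns k)) R₀ x, h y ∂μ) atTop (nhds (h x)) := by
    refine TendstoInMeasure.exists_seq_tendsto_ae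
      (f := fun k x => ⨍ y in iterCut c (sweeps n k) R₀ x, h y ∂μ)
      (tendstoInMeasure_of_tendsto_eLpNorm one_ne_zero (fun k =>
        (stronglyMeasurable_comp_iterCut (fun S => ⨍ y in S, h y ∂μ) _ R₀).aestronglyMeasurable)
        (hint R₀ hR).aestronglyMeasurable ?_)
    simp only [eLpNorm_one_eq_lintegral_enorm]
    exact hlim
  set ψ : Set (Fin n → ℝ) → ENNReal := fun S => ENNReal.ofReal (B (⨍ y in S, h y ∂μ)) with hψ
  have hB : ∀ R, IsChargedBox μ R → 0 ≤ B (⨍ y in R, h y ∂μ) := fun R hR =>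
    hB0 _ (hregion (hmem R hR))
  have hmul : ∀ R, IsChargedBox μ R →
      ψ R * μ R = ENNReal.ofReal (B (⨍ y in R, h y ∂μ) * μ.real R) := fun R hR => by
    rw [ENNReal.ofReal_mul (hB R hR), measureReal_def, ENNReal.ofReal_toReal hR.2.2.ne]
  have hsuper : ∀ R, IsChargedBox μ R → ∀ i : Fin n,
      ψ (R ∩ {x | x i < c R i}) * μ (R ∩ {x | x i < c R i}) +
        ψ (R ∩ {x | c R i < x i}) * μ (R ∩ {x | c R i < x i}) ≤ 1 * (ψ R * μ R) := by
    intro R hR i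
    have h1 := hc₁ R hR i
    have h2 := hc₂ R hR i
    have hM : 0 < μ.real R := ENNReal.toReal_pos hR.2.1.ne' hR.2.2.ne
    have hadd : μ.real R = μ.real (R ∩ {x | x i < c R i}) + μ.real (R ∩ {x | c R i < x i}) := by
      rw [measureReal_def, hμ.measure_eq_add hR.1.measurableSet i (c R i),
        ENNReal.toReal_add h1.2.2.ne h2.2.2.ne]
      rfl
    rw [one_mul, hmul R hR, hmul _ h1, hmul _ h2, ← ENNReal.ofReal_add
      (mul_nonneg (hB _ h1) measureReal_nonneg) (mul_nonneg (hB _ h2) measureReal_nonneg)]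
    apply ENNReal.ofReal_le_ofReal
    have hl : μ.real (R ∩ {x | x i < c R i}) / μ.real R ∈ Icc (0 : ℝ) 1 := by
      refine ⟨by positivity, ?_⟩
      rw [div_le_one hM, hadd]
      linarith [measureReal_nonneg (μ := μ) (s := R ∩ {x | c R i < x i})]
    have hconc := hBconc _ _ (hseg R hR i) _ hl
    rw [← hμ.setAverage_eq_add hR.1.measurableSet hR.2.2.ne hR.2.1.ne' i (c R i) (hint R hR),
      one_sub_div hM.ne', hadd, add_sub_cancel_left, ← hadd, div_mul_eq_mul_div,
      div_mul_eq_mul_div, ← add_div, div_le_iff₀ hM] at hconc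
    linarith
  have hbound : ∀ L, ∫⁻ x in R₀, ψ (iterCut c L R₀ x) ∂μ ≤ ψ R₀ * μ R₀ := fun L => by
    simpa using hc.lintegral_iterCut_le hμ (fun _ => 1) ψ hsuper L hR
  have hmain : ∫⁻ x in R₀, ENNReal.ofReal (w x ^ r) ∂μ ≤ ψ R₀ * μ R₀ := by
    calc _ ≤ ∫⁻ x in R₀, liminf (fun k => ψ (iterCut c (sweeps n (ns k)) R₀ x)) atTop ∂μ := by
          refine lintegral_mono_ae ?_
          filter_upwards [hns, ae_restrict_of_ae hw] with x hx hwx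
          have hxΩ : h x ∈ powEpigraph p ∩ belowCurve p Q₁ :=
            ⟨⟨hwx, le_rfl⟩, Real.rpow_le_rpow hwx.le
              (le_mul_of_one_le_left hwx.le (by linarith)) hp0.le⟩
          have ht : Tendsto (fun k => ψ (iterCut c (sweeps n (ns k)) R₀ x)) atTop
              (nhds (ENNReal.ofReal (B (h x)))) :=
            ENNReal.tendsto_ofReal ((hBcont _ hxΩ).tendsto.comp (tendsto_nhdsWithin_iff.2
              ⟨hx, Eventually.of_forall fun k =>
                hregion (hmem _ (hc.isChargedBox_iterCut _ hR x))⟩))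
          rw [ht.liminf_eq]
          exact ENNReal.ofReal_le_ofReal (hBbdry _ hwx)
      _ ≤ liminf (fun k => ∫⁻ x in R₀, ψ (iterCut c (sweeps n (ns k)) R₀ x) ∂μ) atTop :=
          lintegral_liminf_le fun k => (stronglyMeasurable_comp_iterCut ψ _ R₀).measurable
      _ ≤ liminf (fun _ : ℕ => ψ R₀ * μ R₀) atTop :=
          liminf_le_liminf (Eventually.of_forall fun k => hbound _)
      _ = ψ R₀ * μ R₀ := liminf_const _
  have hM : 0 < μ.real R₀ := ENNReal.toReal_pos hR.2.1.ne' hR.2.2.ne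
  simp only [boxAvg]
  rw [← havg R₀ hR, setAverage_eq, smul_eq_mul, inv_mul_le_iff₀ hM,
    integral_eq_lintegral_of_nonneg_ae
      ((ae_restrict_of_ae hw).mono fun x hx => Real.rpow_nonneg hx.le r)
      (hwm.pow_const r).aestronglyMeasurable, mul_comm]
  rw [hmul R₀ hR] at hmain
  exact ENNReal.toReal_le_of_le_ofReal (mul_nonneg (hB R₀ hR) hM.le) hmain
end
end
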